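/- Call $\ell:(0,\infty)\to(0,\infty)$ slowly varying if it is measurable, bounded above and below by positive constants on each compact subset of $(0,\infty)$, and $\lim_{x\to\infty}\ell(\lambda x)/\ell(x)=1$ for every $\lambda>0$. Let $(Y,\mu)$ be a probability space, $F:Y\to Y$ a measure-preserving map, and $\varphi:Y\to\{1,2,3,\dots\}$ a measurable function with $\mu(\varphi>n)=\ell(n)n^{-\beta}$ for all $n\ge1$, where $\ell$ is slowly varying and $\beta\in(0,1)$. Let $R:L^1(Y,\mu)\to L^1(Y,\mu)$ be the transfer operator of $F$, characterized by $\int_Y (Rv)\,w\,d\mu=\int_Y v\,(w\circ F)\,d\mu$ for all $v\in L^1(Y,\mu)$, $w\in L^\infty(Y,\mu)$, and put $R_nv=R(1_{\{\varphi=n\}}v)$ for $n\ge1$. Let $\mathcal B\subset L^\infty(Y,\mu)$ be a linear subspace that contains the constant functions and is a complex Banach space under a norm $\|\cdot\|$ with $\|v\|_{L^\infty}\le\|v\|$ for all $v\in\mathcal B$. Assume: (H1) Each $R_n$, $n\ge1$, maps $\mathcal B$ boundedly into $\mathcal B$, and there is a constant $C>0$ with $\|R_n\|_{\mathcal B\to\mathcal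 B}\le C\,\mu(\varphi=n)$ for all $n\ge1$. For $|z|\le1$ write $R(z)=\sum_{n\ge1}z^nR_n:\mathcal B\to\mathcal B$. (H2)(i) $1$ is a simple isolated eigenvalue of $R(1)$ on $\mathcal B$: it is an isolated point of the spectrum of $R(1)$ and has algebraic multiplicity one, that is, the spectral projection $\frac1{2\pi i}\oint_{|\zeta-1|=r}(\zeta-R(1))^{-1}\,d\zeta$ has rank one, where $r>0$ is such that $1$ is the only point of the spectrum in $\{|\zeta-1|\le r\}$. (H2)(ii) For every $z\in\mathbb C$ with $|z|\le1$, $z\ne1$, the number $1$ does not belong to the spectrum of $R(z)$ on $\mathcal B$. Define $T_n:\mathcal B\to\mathcal B$ by $T_0=I$ and $T_n=\sum_{j=1}^nT_{n-j}R_j$ for $n\ge1$. Then there is a constant $C'>0$ such that for every $v\in\mathcal B$ with $\int_Y v\,d\mu=0$ and every $n\ge1$, \[ \|T_nv\|\le C'\,\ell(n)\,n^{-\beta}\,\|v\|. \] -/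

import Mathlib

open MeasureTheory Filter Topology

/-- `l : (0,∞) → (0,∞)` is slowly varying (values of `l` outside `(0,∞)` are irrelevant):
it is measurable, bounded above and below by positive constants on each compact subset of
`(0,∞)`, and `l (lam * x) / l x → 1` as `x → ∞` for every `lam > 0`. -/
def SlowlyVarying (l : ℝ → ℝ) : Prop :=
  Measurable (fun x : Set.Ioi (0 : ℝ) => l x) ∧
  (∀ x : ℝ, 0 < x → 0 < l x) ∧
  (∀ K : Set ℝ, IsCompact K → K ⊆ Set.Ioi 0 →
    ∃ c C : ℝ, 0 < c ∧ ∀ x ∈ K, c ≤ l x ∧ l x ≤ C) ∧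
  ∀ lam : ℝ, 0 < lam → Tendsto (fun x => l (lam * x) / l x) atTop (𝓝 1)

/-- The transfer operator of `F` applied to an integrable function `v`: the density with respect
to `μ` of the push-forward under `F` of the complex measure `v μ`. -/
noncomputable def transferOp {Y : Type*} [MeasurableSpace Y] (μ : Measure Y) (F : Y → Y)
    (v : Y → ℂ) : Y → ℂ :=
  ComplexMeasure.rnDeriv ((μ.withDensityᵥ v).map F) μ

theorem integrable_transferOp {Y : Type*} [MeasurableSpace Y] (μ : Measure Y) (F : Y → Y)
    (v : Y → ℂ) : Integrable (transferOp μ F v) μ :=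
  ComplexMeasure.integrable_rnDeriv _ _

theorem setIntegral_transferOp {Y : Type*} [MeasurableSpace Y] {μ : Measure Y}
    [IsProbabilityMeasure μ] {F : Y → Y} (hF : MeasurePreserving F μ μ)
    {v : Y → ℂ} (hv : Integrable v μ) {A : Set Y} (hA : MeasurableSet A) :
    ∫ y in A, transferOp μ F v y ∂μ = ∫ y in F ⁻¹' A, v y ∂μ := by
  set c : ComplexMeasure Y := (μ.withDensityᵥ v).map F with hc
  have hcA : ∀ B, MeasurableSet B → c B = ∫ y in F ⁻¹' B, v y ∂μ := by
    intro B hB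
    rw [hc, VectorMeasure.map_apply _ hF.measurable hB,
      withDensityᵥ_apply hv (hF.measurable hB)]
  have hac : c ≪ᵥ μ.toENNRealVectorMeasure := by
    refine VectorMeasure.AbsolutelyContinuous.mk fun B hB h0 => ?_
    rw [Measure.toENNRealVectorMeasure_apply_measurable hB] at h0
    rw [hcA B hB]
    refine setIntegral_measure_zero _ ?_
    rw [hF.measure_preimage hB.nullMeasurableSet, h0]
  obtain ⟨hre, him⟩ := (ComplexMeasure.absolutelyContinuous_ennreal_iff c _).1 hac
  have h1 := SignedMeasure.absolutelyContinuous_iff_withDensityᵥ_rnDeriv_eq _ μ |>.1 hre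
  have h2 := SignedMeasure.absolutelyContinuous_iff_withDensityᵥ_rnDeriv_eq _ μ |>.1 him
  rw [← hcA A hA]
  have hi : Integrable (c.rnDeriv μ) μ := ComplexMeasure.integrable_rnDeriv _ _
  change ∫ y in A, c.rnDeriv μ y ∂μ = c A
  apply Complex.ext
  · rw [← RCLike.re_eq_complex_re, ← integral_re hi.integrableOn]
    have := congrArg (fun s => s A) h1
    simp only [withDensityᵥ_apply (SignedMeasure.integrable_rnDeriv _ μ) hA] at this
    exact this
  · rw [← RCLike.im_eq_complex_im, ← integral_im hi.integrableOn]
    have := congrArg (fun s => s A) h2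
    simp only [withDensityᵥ_apply (SignedMeasure.integrable_rnDeriv _ μ) hA] at this
    exact this

/-- The duality formula that characterizes the transfer operator. -/
theorem integral_transferOp_mul {Y : Type*} [MeasurableSpace Y] {μ : Measure Y}
    [IsProbabilityMeasure μ] {F : Y → Y} (hF : MeasurePreserving F μ μ)
    {v : Y → ℂ} (hv : Integrable v μ) {w : Y → ℂ} (hw : Measurable w) {M : ℝ}
    (hM : ∀ y, ‖w y‖ ≤ M) :
    ∫ y, transferOp μ F v y * w y ∂μ = ∫ y, v y * w (F y) ∂μ := by
  have hu : Integrable (transferOp μ F v) μ := integrable_transferOp μ F v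
  have hbd : ∀ {g : Y → ℂ}, Integrable g μ → ∀ {h : Y → ℂ}, Measurable h → ∀ {K : ℝ},
      (∀ y, ‖h y‖ ≤ K) → Integrable (fun y => g y * h y) μ := by
    intro g hg h hh K hK
    exact hg.mul_bdd (c := K) hh.aestronglyMeasurable (Eventually.of_forall hK)
  have hs : ∀ s : SimpleFunc Y ℂ,
      ∫ y, transferOp μ F v y * s y ∂μ = ∫ y, v y * s (F y) ∂μ := by
    intro s
    induction s using SimpleFunc.induction with
    | @const a A hA =>
      have e1 : ∀ y, transferOp μ F v y *
          (SimpleFunc.piecewise A hA (SimpleFunc.const Y a) (SimpleFunc.const Y 0)) y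
          = A.indicator (fun y => transferOp μ F v y * a) y := by
        intro y
        by_cases hy : y ∈ A <;> simp [SimpleFunc.piecewise_apply, hy]
      have e2 : ∀ y, v y *
          (SimpleFunc.piecewise A hA (SimpleFunc.const Y a) (SimpleFunc.const Y 0)) (F y)
          = (F ⁻¹' A).indicator (fun y => v y * a) y := by
        intro y
        by_cases hy : F y ∈ A <;> simp [SimpleFunc.piecewise_apply, hy]
      simp only [e1, e2]
      rw [integral_indicator hA, integral_indicator (hF.measurable hA),
        integral_mul_const, integral_mul_const, setIntegral_transferOp hF hv hA]
    | @add f g _ hf hg =>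
      obtain ⟨Kf, hKf⟩ := f.exists_forall_norm_le
      obtain ⟨Kg, hKg⟩ := g.exists_forall_norm_le
      simp only [SimpleFunc.coe_add, Pi.add_apply, mul_add]
      rw [integral_add (hbd hu f.measurable hKf) (hbd hu g.measurable hKg),
        hf, hg]
      exact (integral_add (hbd hv (f.measurable.comp hF.measurable) fun y => hKf (F y))
        (hbd hv (g.measurable.comp hF.measurable) fun y => hKg (F y))).symm
  have hM0 : 0 ≤ M := by
    obtain ⟨y⟩ : Nonempty Y := nonempty_of_isProbabilityMeasure μ
    exact (norm_nonneg _).trans (hM y)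
  have hws : StronglyMeasurable w := hw.stronglyMeasurable
  have t1 : Tendsto (fun n => ∫ y, transferOp μ F v y * hws.approxBounded M n y ∂μ) atTop
      (𝓝 (∫ y, transferOp μ F v y * w y ∂μ)) := by
    refine tendsto_integral_of_dominated_convergence (fun y => ‖transferOp μ F v y‖ * M)
      (fun n => (hbd hu (SimpleFunc.measurable _)
        (hws.norm_approxBounded_le hM0 n)).aestronglyMeasurable) (hu.norm.mul_const M) ?_ ?_
    · refine fun n => Eventually.of_forall fun y => ?_
      rw [norm_mul]
      exact mul_le_mul_of_nonneg_left (hws.norm_approxBounded_le hM0 n y) (norm_nonneg _)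
    · exact Eventually.of_forall fun y =>
        (hws.tendsto_approxBounded_of_norm_le (hM y)).const_mul _
  have t2 : Tendsto (fun n => ∫ y, v y * hws.approxBounded M n (F y) ∂μ) atTop
      (𝓝 (∫ y, v y * w (F y) ∂μ)) := by
    refine tendsto_integral_of_dominated_convergence (fun y => ‖v y‖ * M)
      (fun n => (hbd hv ((SimpleFunc.measurable _).comp hF.measurable)
        (fun y => hws.norm_approxBounded_le hM0 n (F y))).aestronglyMeasurable)
      (hv.norm.mul_const M) ?_ ?_
    · refine fun n => Eventually.of_forall fun y => ?_
      rw [norm_mul]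
      exact mul_le_mul_of_nonneg_left (hws.norm_approxBounded_le hM0 n (F y)) (norm_nonneg _)
    · exact Eventually.of_forall fun y =>
        (hws.tendsto_approxBounded_of_norm_le (hM (F y))).const_mul _
  simp only [hs] at t1
  exact tendsto_nhds_unique t1 t2

section Operators

variable {B : Type*} [NormedAddCommGroup B] [NormedSpace ℂ B]

/-- The operator power series `R(z) = ∑_{n ≥ 1} zⁿ Rₙ` (the value of `Rn` at `0` is not used). -/
noncomputable def renewalSeries (Rn : ℕ → B →L[ℂ] B) (z : ℂ) : B →L[ℂ] B :=
  ∑' n : ℕ, z ^ (n + 1) • Rn (n + 1)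

/-- The renewal operators: `T₀ = I` and `Tₙ = ∑_{j=1}^{n} T_{n-j} Rⱼ` for `n ≥ 1`. In the second
clause the summation variable is `j - 1`. -/
noncomputable def renewalOp (Rn : ℕ → B →L[ℂ] B) : ℕ → B →L[ℂ] B
  | 0 => ContinuousLinearMap.id ℂ B
  | n + 1 => ∑ i : Fin (n + 1), (renewalOp Rn (n - (i : ℕ))).comp (Rn ((i : ℕ) + 1))
  termination_by n => n
  decreasing_by omega

/-- The Riesz integral `(2πi)⁻¹ ∮_{|ζ - c| = r} (ζ - A)⁻¹ dζ`. -/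
noncomputable def rieszProjection (A : B →L[ℂ] B) (c : ℂ) (r : ℝ) : B →L[ℂ] B :=
  (2 * (Real.pi : ℂ) * Complex.I)⁻¹ • ∮ ζ in C(c, r), resolvent A ζ

/-- `c` is a simple isolated eigenvalue of `A`: it is an isolated point of the spectrum, and the
spectral projection of `A` belonging to `{c}` has rank one, i.e. `c` has algebraic multiplicity
one. The spectral projection is the Riesz integral over any circle around `c` that, together with
its interior, contains no further point of the spectrum. -/
def IsSimpleIsolatedEigenvalue (A : B →L[ℂ] B) (c : ℂ) : Prop :=
  ∃ r : ℝ, 0 < r ∧ spectrum ℂ A ∩ Metric.closedBall c r = {c} ∧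
    Module.finrank ℂ (LinearMap.range (rieszProjection A c r : B →ₗ[ℂ] B)) = 1

end Operators

/-! ### Regularly varying tails -/

theorem tail_le_rpow_mul_tail {s : ℕ → ℝ} (hs : Antitone s) (hpos : ∀ n, 0 < s n)
    (hs1 : ∀ n, s n ≤ 1) {γ : ℝ} (hγ : 0 < γ) {m₀ : ℕ} (hm₀ : 1 ≤ m₀)
    (h : ∀ m ≥ m₀, (2 : ℝ) ^ (-γ) * s m ≤ s (2 * m)) :
    ∃ K > 0, ∀ j n : ℕ, 1 ≤ j → j ≤ n → s j ≤ K * ((n : ℝ) / j) ^ γ * s n := by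
  have h2 : (2 : ℝ) ^ γ * 2 ^ (-γ) = 1 := by
    rw [← Real.rpow_add two_pos]; simp
  have h2pos : (0 : ℝ) < 2 ^ γ := by positivity
  have hdouble : ∀ m ≥ m₀, s m ≤ 2 ^ γ * s (2 * m) := fun m hm => by
    have := mul_le_mul_of_nonneg_left (h m hm) h2pos.le
    rwa [← mul_assoc, h2, one_mul] at this
  have hge1 : ∀ j n : ℕ, 1 ≤ j → j ≤ n → 1 ≤ ((n : ℝ) / j) ^ γ := fun j n hj hn => by
    refine Real.one_le_rpow ?_ hγ.le
    rw [one_le_div (by exact_mod_cast hj)]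
    exact_mod_cast hn
  have large : ∀ d j n : ℕ, n - j = d → m₀ ≤ j → j ≤ n →
      s j ≤ 2 ^ γ * ((n : ℝ) / j) ^ γ * s n := by
    intro d
    induction d using Nat.strong_induction_on with
    | _ d ih =>
      intro j n hd hj hn
      have hj1 : 1 ≤ j := hm₀.trans hj
      by_cases hn2 : n ≤ 2 * j
      · calc s j ≤ 2 ^ γ * s (2 * j) := hdouble j hj
          _ ≤ 2 ^ γ * s n := mul_le_mul_of_nonneg_left (hs hn2) h2pos.le
          _ ≤ 2 ^ γ * ((n : ℝ) / j) ^ γ * s n := by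
            refine mul_le_mul_of_nonneg_right ?_ (hpos n).le
            exact le_mul_of_one_le_right h2pos.le (hge1 j n hj1 hn)
      · push Not at hn2
        have := ih (n - 2 * j) (by omega) (2 * j) n rfl (by omega) hn2.le
        have hj0 : (0 : ℝ) < j := by exact_mod_cast hj1
        have e : (2 : ℝ) ^ γ * ((n : ℝ) / (2 * j : ℕ)) ^ γ = ((n : ℝ) / j) ^ γ := by
          rw [← Real.mul_rpow two_pos.le (by positivity)]
          congr 1
          push_cast
          field_simp
        rw [e] at this
        calc s j ≤ 2 ^ γ * s (2 * j) := hdouble j hj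
          _ ≤ 2 ^ γ * (((n : ℝ) / j) ^ γ * s n) := mul_le_mul_of_nonneg_left this h2pos.le
          _ = _ := by ring
  have hm₀pos := hpos m₀
  have hKone : 1 ≤ 2 ^ γ / s m₀ := by
    rw [one_le_div hm₀pos]
    exact (hs1 _).trans (Real.one_le_rpow one_le_two hγ.le)
  refine ⟨2 ^ γ / s m₀, by positivity, fun j n hj hn => ?_⟩
  have hK2 : 2 ^ γ ≤ 2 ^ γ / s m₀ := by
    rw [le_div_iff₀ hm₀pos]
    exact mul_le_of_le_one_right h2pos.le (hs1 _)
  have hn0 := hpos n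
  have hq := hge1 j n hj hn
  by_cases hjm : m₀ ≤ j
  · refine (large _ j n rfl hjm hn).trans ?_
    gcongr
  · push Not at hjm
    by_cases hnm : m₀ ≤ n
    · have hb := large _ m₀ n rfl le_rfl hnm
      have hj0 : (0 : ℝ) < j := by exact_mod_cast hj
      have hmono : ((n : ℝ) / m₀) ^ γ ≤ ((n : ℝ) / j) ^ γ := by
        refine Real.rpow_le_rpow (by positivity) ?_ hγ.le
        gcongr
      calc s j ≤ 1 := hs1 j
        _ = s m₀ / s m₀ := (div_self hm₀pos.ne').symm
        _ ≤ (2 ^ γ * ((n : ℝ) / m₀) ^ γ * s n) / s m₀ := by gcongr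
        _ ≤ (2 ^ γ * ((n : ℝ) / j) ^ γ * s n) / s m₀ := by gcongr
        _ = _ := by ring
    · push Not at hnm
      calc s j ≤ 1 := hs1 j
        _ = s m₀ / s m₀ := (div_self hm₀pos.ne').symm
        _ ≤ s n / s m₀ := by gcongr; exact hs hnm.le
        _ = 1 * 1 * s n / s m₀ := by ring
        _ ≤ (2 ^ γ * ((n : ℝ) / j) ^ γ * s n) / s m₀ := by
          gcongr
          exact Real.one_le_rpow one_le_two hγ.le
        _ = _ := by ring

theorem sum_rpow_neg_le {γ : ℝ} (hγ0 : 0 < γ) (hγ1 : γ < 1) (n : ℕ) :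
    ∑ k ∈ Finset.range n, ((k + 1 : ℕ) : ℝ) ^ (-γ) ≤ (1 - γ)⁻¹ * (n : ℝ) ^ (1 - γ) := by
  have hg : 0 < 1 - γ := by linarith
  induction n with
  | zero => simp [Real.zero_rpow hg.ne']
  | succ n ih =>
    rw [Finset.sum_range_succ]
    have hx : (0 : ℝ) < ((n + 1 : ℕ) : ℝ) := by positivity
    have hb : (1 + -(((n + 1 : ℕ) : ℝ))⁻¹) ^ (1 - γ) ≤ 1 + (1 - γ) * -(((n + 1 : ℕ) : ℝ))⁻¹ := by
      refine rpow_one_add_le_one_add_mul_self ?_ hg.le (by linarith)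
      rw [neg_le_neg_iff]
      exact inv_le_one_of_one_le₀ (by push_cast; linarith [(n.cast_nonneg : (0 : ℝ) ≤ n)])
    have e1 : (n : ℝ) = ((n + 1 : ℕ) : ℝ) * (1 + -(((n + 1 : ℕ) : ℝ))⁻¹) := by
      rw [mul_add, mul_neg, mul_inv_cancel₀ hx.ne']; push_cast; ring
    have h0 : 0 ≤ 1 + -(((n + 1 : ℕ) : ℝ))⁻¹ := by
      have : (((n + 1 : ℕ) : ℝ))⁻¹ ≤ 1 :=
        inv_le_one_of_one_le₀ (by push_cast; linarith [(n.cast_nonneg : (0 : ℝ) ≤ n)])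
      linarith
    have e2 : (n : ℝ) ^ (1 - γ) ≤ ((n + 1 : ℕ) : ℝ) ^ (1 - γ) -
        (1 - γ) * ((n + 1 : ℕ) : ℝ) ^ (-γ) := by
      conv_lhs => rw [e1, Real.mul_rpow hx.le h0]
      refine (mul_le_mul_of_nonneg_left hb (by positivity)).trans_eq ?_
      have : ((n + 1 : ℕ) : ℝ) ^ (1 - γ) * (((n + 1 : ℕ) : ℝ))⁻¹ = ((n + 1 : ℕ) : ℝ) ^ (-γ) := by
        rw [← Real.rpow_neg_one, ← Real.rpow_add hx]; congr 1; ring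
      rw [← this]; ring
    calc _ ≤ (1 - γ)⁻¹ * (n : ℝ) ^ (1 - γ) + ((n + 1 : ℕ) : ℝ) ^ (-γ) := by linarith
      _ ≤ (1 - γ)⁻¹ * (((n + 1 : ℕ) : ℝ) ^ (1 - γ) - (1 - γ) * ((n + 1 : ℕ) : ℝ) ^ (-γ))
          + ((n + 1 : ℕ) : ℝ) ^ (-γ) := by gcongr
      _ = _ := by field_simp; ring

theorem sum_tail_le {s : ℕ → ℝ} (hpos : ∀ n, 0 < s n)
    (hs1 : ∀ n, s n ≤ 1) {γ : ℝ} (hγ : 0 < γ) (hγ1 : γ < 1) {K : ℝ} (hK : 0 < K)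
    (h : ∀ j n : ℕ, 1 ≤ j → j ≤ n → s j ≤ K * ((n : ℝ) / j) ^ γ * s n) :
    ∃ L > 0, ∀ n : ℕ, 1 ≤ n → ∑ k ∈ Finset.range n, s k ≤ L * (n * s n) := by
  have hg : 0 < 1 - γ := by linarith
  refine ⟨K / s 1 + K * (1 - γ)⁻¹, by have := hpos 1; positivity, fun n hn => ?_⟩
  obtain ⟨n, rfl⟩ : ∃ k, n = k + 1 := ⟨n - 1, by omega⟩
  rw [Finset.sum_range_succ']
  set N : ℕ := n + 1 with hN
  have hN0 : (0 : ℝ) < N := by positivity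
  have hsN := hpos N
  have hterm : ∀ k ∈ Finset.range n, s (k + 1) ≤
      K * (N : ℝ) ^ γ * s N * ((k + 1 : ℕ) : ℝ) ^ (-γ) := fun k hk => by
    have := h (k + 1) N (by omega) (by have := Finset.mem_range.1 hk; omega)
    rw [Real.div_rpow hN0.le (by positivity)] at this
    rw [Real.rpow_neg (by positivity)]
    refine this.trans_eq ?_
    rw [div_eq_mul_inv]; ring
  have hsum : ∑ k ∈ Finset.range n, s (k + 1) ≤ K * (1 - γ)⁻¹ * (N * s N) := by
    calc _ ≤ ∑ k ∈ Finset.range n, K * (N : ℝ) ^ γ * s N * ((k + 1 : ℕ) : ℝ) ^ (-γ) :=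
          Finset.sum_le_sum hterm
      _ = K * (N : ℝ) ^ γ * s N * ∑ k ∈ Finset.range n, ((k + 1 : ℕ) : ℝ) ^ (-γ) := by
          rw [Finset.mul_sum]
      _ ≤ K * (N : ℝ) ^ γ * s N * ((1 - γ)⁻¹ * (N : ℝ) ^ (1 - γ)) := by
          refine mul_le_mul_of_nonneg_left ((sum_rpow_neg_le hγ hγ1 n).trans ?_) (by positivity)
          gcongr
          omega
      _ = K * (1 - γ)⁻¹ * (((N : ℝ) ^ γ * (N : ℝ) ^ (1 - γ)) * s N) := by ring
      _ = _ := by rw [← Real.rpow_add hN0]; simp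
  have h0 : s 0 ≤ K / s 1 * (N * s N) := by
    have h1 := h 1 N le_rfl (by omega)
    have hNγ : ((N : ℝ) / (1 : ℕ)) ^ γ ≤ N := by
      rw [Nat.cast_one, div_one]
      exact Real.rpow_le_self_of_one_le (by exact_mod_cast (by omega : 1 ≤ N)) hγ1.le
    have hp1 := hpos 1
    calc s 0 ≤ 1 := hs1 0
      _ = s 1 / s 1 := (div_self hp1.ne').symm
      _ ≤ (K * N * s N) / s 1 := by gcongr; exact h1.trans (by gcongr)
      _ = _ := by ring
  calc _ ≤ K * (1 - γ)⁻¹ * (N * s N) + K / s 1 * (N * s N) := add_le_add hsum h0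
    _ = _ := by ring

theorem SlowlyVarying.tendsto_tail_ratio {l : ℝ → ℝ} (hl : SlowlyVarying l) {β : ℝ} {s : ℕ → ℝ}
    (hs : ∀ n : ℕ, 1 ≤ n → s n = l n * (n : ℝ) ^ (-β)) :
    Tendsto (fun m : ℕ => s (2 * m) / s m) atTop (𝓝 ((2 : ℝ) ^ (-β))) := by
  have h := (hl.2.2.2 2 two_pos).comp tendsto_natCast_atTop_atTop
  have h' := h.mul_const ((2 : ℝ) ^ (-β))
  rw [one_mul] at h'
  refine h'.congr' ?_
  filter_upwards [eventually_ge_atTop 1] with m hm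
  have hm0 : (0 : ℝ) < m := by exact_mod_cast hm
  have hx : (m : ℝ) ^ (-β) ≠ 0 := by positivity
  have hy := (hl.2.1 m hm0).ne'
  rw [hs m hm, hs (2 * m) (by omega)]
  simp only [Function.comp]
  push_cast
  rw [Real.mul_rpow two_pos.le hm0.le]
  field_simp

/-- The three consequences of regular variation of the tail that are used below. -/
theorem exists_tail_bounds {s : ℕ → ℝ} (hs : Antitone s) (hpos : ∀ n, 0 < s n)
    (hs1 : ∀ n, s n ≤ 1) {β : ℝ} (hβ0 : 0 < β) (hβ1 : β < 1)
    (hlim : Tendsto (fun m : ℕ => s (2 * m) / s m) atTop (𝓝 ((2 : ℝ) ^ (-β)))) :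
    (∃ γ K : ℝ, 0 < γ ∧ γ < 1 ∧ ∀ n : ℕ, 1 ≤ n → (s n)⁻¹ ≤ K * (n : ℝ) ^ γ) ∧
    (∃ L > 0, ∀ n : ℕ, 1 ≤ n → ∑ k ∈ Finset.range n, s k ≤ L * (n * s n)) ∧
    ∃ c > 0, ∃ m₀ : ℕ, ∀ m ≥ m₀, c * s m ≤ s m - s (2 * m) := by
  obtain ⟨γ, hγβ, hγ1⟩ := exists_between hβ1
  have hγ0 : 0 < γ := hβ0.trans hγβ
  have hev : ∀ᶠ m : ℕ in atTop, (2 : ℝ) ^ (-γ) < s (2 * m) / s m :=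
    hlim.eventually_const_lt (Real.rpow_lt_rpow_of_exponent_lt one_lt_two (by linarith))
  obtain ⟨m₁, hm₁⟩ := eventually_atTop.1 hev
  obtain ⟨K, hK, hKs⟩ := tail_le_rpow_mul_tail hs hpos hs1 hγ0 (le_max_right m₁ 1)
    (fun m hm => ((lt_div_iff₀ (hpos m)).1 (hm₁ m ((le_max_left _ _).trans hm))).le)
  refine ⟨⟨γ, K / s 1, hγ0, hγ1, fun n hn => ?_⟩,
    sum_tail_le hpos hs1 hγ0 hγ1 hK hKs, ?_⟩
  · have := hKs 1 n le_rfl hn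
    rw [Nat.cast_one, div_one] at this
    rw [inv_le_iff_one_le_mul₀ (hpos n), div_mul_eq_mul_div, div_mul_eq_mul_div, one_le_div (hpos 1)]
    exact this
  · have hlt : (2 : ℝ) ^ (-β) < 1 := Real.rpow_lt_one_of_one_lt_of_neg one_lt_two (by linarith)
    obtain ⟨q, hq, hq1⟩ := exists_between hlt
    obtain ⟨m₀, hm₀⟩ := eventually_atTop.1 (hlim.eventually_lt_const hq)
    refine ⟨1 - q, by linarith, m₀, fun m hm => ?_⟩
    have := ((div_lt_iff₀ (hpos m)).1 (hm₀ m hm)).le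
    linarith

/-! ### The operator power series on the closed unit disk -/

theorem norm_pow_sub_pow_le_of_norm_le_one {z w : ℂ} (hz : ‖z‖ ≤ 1) (hw : ‖w‖ ≤ 1) (n : ℕ) :
    ‖z ^ n - w ^ n‖ ≤ n * ‖z - w‖ := by
  induction n with
  | zero => simp
  | succ n ih =>
    have e : z ^ (n + 1) - w ^ (n + 1) = z * (z ^ n - w ^ n) + (z - w) * w ^ n := by ring
    rw [e]
    have h1 : ‖z * (z ^ n - w ^ n)‖ ≤ n * ‖z - w‖ := by
      rw [norm_mul]
      exact (mul_le_of_le_one_left (norm_nonneg _) hz).trans ih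
    have h2 : ‖(z - w) * w ^ n‖ ≤ ‖z - w‖ := by
      rw [norm_mul, norm_pow]
      exact mul_le_of_le_one_right (norm_nonneg _) (pow_le_one₀ (norm_nonneg _) hw)
    refine (norm_add_le_of_le h1 h2).trans_eq ?_
    push_cast
    ring

theorem norm_pow_sub_pow_le_two {z w : ℂ} (hz : ‖z‖ ≤ 1) (hw : ‖w‖ ≤ 1) (n : ℕ) :
    ‖z ^ n - w ^ n‖ ≤ 2 := by
  refine (norm_sub_le _ _).trans ?_
  rw [norm_pow, norm_pow]
  linarith [pow_le_one₀ (norm_nonneg z) hz (n := n), pow_le_one₀ (norm_nonneg w) hw (n := n)]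

/-- If `n |1 - z| ≤ 1` then `|1 - zⁿ|` is comparable to `n |1 - z|`. -/
theorem half_mul_norm_le_norm_one_sub_pow {z : ℂ} (hz : ‖z‖ ≤ 1) {n : ℕ}
    (hn : n * ‖1 - z‖ ≤ 1) : n * ‖1 - z‖ / 2 ≤ ‖1 - z ^ n‖ := by
  have hk : ∀ k ∈ Finset.range n, ‖1 - z ^ k‖ ≤ k * ‖1 - z‖ := fun k _ => by
    simpa using norm_pow_sub_pow_le_of_norm_le_one (z := 1) (by simp) hz k
  have hsum : ‖(n : ℂ) - ∑ k ∈ Finset.range n, z ^ k‖ ≤ n / 2 := by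
    have e : (n : ℂ) - ∑ k ∈ Finset.range n, z ^ k = ∑ k ∈ Finset.range n, (1 - z ^ k) := by
      simp
    rw [e]
    refine (norm_sum_le_of_le _ hk).trans ?_
    rw [← Finset.sum_mul, ← Nat.cast_sum]
    have h2 : ((∑ k ∈ Finset.range n, k : ℕ) : ℝ) * 2 ≤ n * n := by
      have := Finset.sum_range_id_mul_two n
      calc ((∑ k ∈ Finset.range n, k : ℕ) : ℝ) * 2 = ((n * (n - 1) : ℕ) : ℝ) := by
            rw [← this]; push_cast; ring
        _ ≤ ((n * n : ℕ) : ℝ) := by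
            exact_mod_cast Nat.mul_le_mul_left n (Nat.sub_le n 1)
        _ = _ := by push_cast; ring
    have h3 : (n : ℝ) * (n * ‖1 - z‖) ≤ n * 1 :=
      mul_le_mul_of_nonneg_left hn n.cast_nonneg
    nlinarith [mul_le_mul_of_nonneg_right h2 (norm_nonneg (1 - z))]
  have hlow : (n : ℝ) / 2 ≤ ‖∑ k ∈ Finset.range n, z ^ k‖ := by
    have := norm_sub_norm_le (n : ℂ) (∑ k ∈ Finset.range n, z ^ k)
    rw [Complex.norm_natCast] at this
    linarith
  have e : 1 - z ^ n = (∑ k ∈ Finset.range n, z ^ k) * (1 - z) := (geom_sum_mul_neg z n).symm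
  rw [e, norm_mul]
  calc n * ‖1 - z‖ / 2 = n / 2 * ‖1 - z‖ := by ring
    _ ≤ _ := mul_le_mul_of_nonneg_right hlow (norm_nonneg _)

theorem sq_norm_one_sub_le_re {w : ℂ} (hw : ‖w‖ ≤ 1) : ‖1 - w‖ ^ 2 / 2 ≤ (1 - w).re := by
  have h1 : ‖w‖ ^ 2 ≤ 1 := pow_le_one₀ (norm_nonneg _) hw
  rw [← Complex.normSq_eq_norm_sq, Complex.normSq_apply] at h1 ⊢
  simp only [Complex.sub_re, Complex.sub_im, Complex.one_re, Complex.one_im]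
  nlinarith

section Tail

variable {p s : ℕ → ℝ}

theorem tail_eq_add_tail (hps : Summable p) (hs : ∀ n, s n = ∑' k, p (k + n + 1)) (n : ℕ) :
    s n = p (n + 1) + s (n + 1) := by
  rw [hs, hs]
  simp only [add_assoc]
  rw [((summable_nat_add_iff (n + 1)).2 hps).tsum_eq_zero_add, zero_add]
  congr 2
  funext k
  congr 1
  ring

theorem sum_mul_add_tail (hps : Summable p) (hs : ∀ n, s n = ∑' k, p (k + n + 1)) (n : ℕ) :
    ∑ k ∈ Finset.range n, ((k + 1 : ℕ) : ℝ) * p (k + 1) + n * s n = ∑ k ∈ Finset.range n, s k := by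
  induction n with
  | zero => simp
  | succ n ih =>
    rw [Finset.sum_range_succ, Finset.sum_range_succ, ← ih]
    have := tail_eq_add_tail hps hs n
    rw [this]
    push_cast
    ring

theorem sum_Ico_eq_tail_sub (hps : Summable p) (hs : ∀ n, s n = ∑' k, p (k + n + 1)) {m n : ℕ}
    (hmn : m ≤ n) : ∑ k ∈ Finset.Ico m n, p (k + 1) = s m - s n := by
  induction n, hmn using Nat.le_induction with
  | base => simp
  | succ n hn ih =>
    rw [Finset.sum_Ico_succ_top hn, ih]
    linarith [tail_eq_add_tail hps hs n]

/-- Lower bound for `1 - ∑ pₙ zⁿ` at distance about `1 / m` from `z = 1`. -/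
theorem tail_sub_le_re_one_sub_tsum (hp : ∀ n, 0 ≤ p n) (hps : Summable p)
    (hs : ∀ n, s n = ∑' k, p (k + n + 1)) (hs0 : s 0 = 1) {z : ℂ} (hz : ‖z‖ ≤ 1) {m : ℕ}
    (h1 : 2 * m * ‖1 - z‖ ≤ 1) (h2 : 1 / 4 ≤ m * ‖1 - z‖) :
    (s m - s (2 * m)) / 128 ≤ (1 - ∑' n : ℕ, z ^ (n + 1) * (p (n + 1) : ℂ)).re := by
  have hps1 : Summable fun n => p (n + 1) := (summable_nat_add_iff 1).2 hps
  have hsum1 : HasSum (fun n => ((p (n + 1) : ℝ) : ℂ)) 1 := by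
    have : HasSum (fun n => p (n + 1)) 1 := by
      have h := hps1.hasSum
      rwa [show ∑' n, p (n + 1) = 1 by rw [← hs0, hs 0]] at h
    simpa using Complex.hasSum_ofReal.2 this
  have hsumz : Summable fun n : ℕ => z ^ (n + 1) * (p (n + 1) : ℂ) := by
    refine Summable.of_norm_bounded hps1 fun n => ?_
    rw [norm_mul, norm_pow, Complex.norm_real, Real.norm_of_nonneg (hp _)]
    exact mul_le_of_le_one_left (hp _) (pow_le_one₀ (norm_nonneg _) hz)
  have hre := Complex.hasSum_re (hsum1.sub hsumz.hasSum)
  have hterm : ∀ n : ℕ, ((p (n + 1) : ℂ) - z ^ (n + 1) * (p (n + 1) : ℂ)).re =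
      p (n + 1) * (1 - z ^ (n + 1)).re := fun n => by
    have : (p (n + 1) : ℂ) - z ^ (n + 1) * (p (n + 1) : ℂ) =
        (p (n + 1) : ℂ) * (1 - z ^ (n + 1)) := by ring
    rw [this, Complex.re_ofReal_mul]
  simp only [hterm] at hre
  have hpow : ∀ n : ℕ, ‖z ^ n‖ ≤ 1 := fun n => by
    rw [norm_pow]; exact pow_le_one₀ (norm_nonneg _) hz
  have hnn : ∀ n : ℕ, 0 ≤ (1 - z ^ (n + 1)).re := fun n =>
    le_trans (by positivity) (sq_norm_one_sub_le_re (hpow _))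
  refine le_trans ?_ (sum_le_hasSum (Finset.Ico m (2 * m))
    (fun n _ => mul_nonneg (hp _) (hnn n)) hre)
  rw [← sum_Ico_eq_tail_sub hps hs (by omega : m ≤ 2 * m), Finset.sum_div]
  refine Finset.sum_le_sum fun n hn => ?_
  obtain ⟨hn1, hn2⟩ := Finset.mem_Ico.1 hn
  rw [div_eq_mul_inv]
  refine mul_le_mul_of_nonneg_left ?_ (hp _)
  refine le_trans ?_ (sq_norm_one_sub_le_re (hpow _))
  have hle : ((n + 1 : ℕ) : ℝ) ≤ 2 * m := by exact_mod_cast hn2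
  have hge : (m : ℝ) ≤ ((n + 1 : ℕ) : ℝ) := by exact_mod_cast hn1.trans n.le_succ
  have hb := half_mul_norm_le_norm_one_sub_pow hz (n := n + 1)
    ((mul_le_mul_of_nonneg_right hle (norm_nonneg _)).trans h1)
  have h8 : 1 / 8 ≤ ‖1 - z ^ (n + 1)‖ := by
    have := mul_le_mul_of_nonneg_right hge (norm_nonneg (1 - z))
    linarith
  have := pow_le_pow_left₀ (by norm_num) h8 2
  linarith

end Tail

section Series

variable {B : Type*} [NormedAddCommGroup B] [NormedSpace ℂ B]
  {Rn : ℕ → B →L[ℂ] B} {p s : ℕ → ℝ} {C : ℝ}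

theorem norm_renewal_term_le (hR : ∀ n : ℕ, 1 ≤ n → ‖Rn n‖ ≤ C * p n) {z : ℂ} (hz : ‖z‖ ≤ 1)
    (n : ℕ) : ‖z ^ (n + 1) • Rn (n + 1)‖ ≤ C * p (n + 1) := by
  rw [norm_smul, norm_pow]
  exact (mul_le_of_le_one_left (norm_nonneg _) (pow_le_one₀ (norm_nonneg _) hz)).trans
    (hR _ (by omega))

theorem summable_renewal_bound (hps : Summable p) : Summable fun n => C * p (n + 1) :=
  ((summable_nat_add_iff 1).2 hps).mul_left C

variable [CompleteSpace B]

theorem summable_renewal_term (hps : Summable p) (hR : ∀ n : ℕ, 1 ≤ n → ‖Rn n‖ ≤ C * p n)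
    {z : ℂ} (hz : ‖z‖ ≤ 1) : Summable fun n : ℕ => z ^ (n + 1) • Rn (n + 1) :=
  .of_norm_bounded (summable_renewal_bound hps) (norm_renewal_term_le hR hz)

theorem continuousOn_renewalSeries (hps : Summable p)
    (hR : ∀ n : ℕ, 1 ≤ n → ‖Rn n‖ ≤ C * p n) :
    ContinuousOn (renewalSeries Rn) (Metric.closedBall 0 1) :=
  continuousOn_tsum (fun n => by fun_prop) (summable_renewal_bound (C := C) hps)
    fun n z hz => norm_renewal_term_le hR (by simpa using hz) n

theorem differentiableOn_renewalSeries (hps : Summable p)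
    (hR : ∀ n : ℕ, 1 ≤ n → ‖Rn n‖ ≤ C * p n) :
    DifferentiableOn ℂ (renewalSeries Rn) (Metric.ball 0 1) :=
  Complex.differentiableOn_tsum_of_summable_norm (summable_renewal_bound (C := C) hps)
    (fun n => by fun_prop) Metric.isOpen_ball
    fun n z hz => norm_renewal_term_le hR (by simpa using (Metric.mem_ball.1 hz).le) n

theorem norm_renewalSeries_sub_le (hp : ∀ n, 0 ≤ p n) (hps : Summable p)
    (hs : ∀ n, s n = ∑' k, p (k + n + 1)) (hC : 0 ≤ C)
    (hR : ∀ n : ℕ, 1 ≤ n → ‖Rn n‖ ≤ C * p n) {L : ℝ}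
    (hL : ∀ n : ℕ, 1 ≤ n → ∑ k ∈ Finset.range n, s k ≤ L * (n * s n))
    {z w : ℂ} (hz : ‖z‖ ≤ 1) (hw : ‖w‖ ≤ 1) {n : ℕ} (hn : 1 ≤ n) (hzw : ‖z - w‖ ≤ 4 / n) :
    ‖renewalSeries Rn z - renewalSeries Rn w‖ ≤ C * (4 * L + 2) * s n := by
  have hn0 : (0 : ℝ) < n := by exact_mod_cast hn
  set q : ℕ → ℝ := fun k => p (k + 1) * min 2 (((k + 1 : ℕ) : ℝ) * (4 / n)) with hq
  have hps1 : Summable fun k => p (k + 1) := (summable_nat_add_iff 1).2 hps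
  have hq2 : ∀ k, q k ≤ 2 * p (k + 1) := fun k => by
    rw [mul_comm 2]
    exact mul_le_mul_of_nonneg_left (min_le_left _ _) (hp _)
  have hq0 : ∀ k, 0 ≤ q k := fun k => mul_nonneg (hp _) (by positivity)
  have hqs : Summable q := .of_nonneg_of_le hq0 hq2 (hps1.mul_left 2)
  have hterm : ∀ k : ℕ, ‖z ^ (k + 1) • Rn (k + 1) - w ^ (k + 1) • Rn (k + 1)‖ ≤ C * q k := by
    intro k
    rw [← sub_smul, norm_smul]
    have h1 : ‖z ^ (k + 1) - w ^ (k + 1)‖ ≤ min 2 (((k + 1 : ℕ) : ℝ) * (4 / n)) :=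
      le_min (norm_pow_sub_pow_le_two hz hw _)
        ((norm_pow_sub_pow_le_of_norm_le_one hz hw _).trans (by gcongr))
    calc _ ≤ min 2 (((k + 1 : ℕ) : ℝ) * (4 / n)) * (C * p (k + 1)) :=
          mul_le_mul h1 (hR _ (by omega)) (norm_nonneg _) (by positivity)
      _ = _ := by simp only [hq]; ring
  have hqn : ∑' k, q k ≤ (4 * L + 2) * s n := by
    rw [← hqs.sum_add_tsum_nat_add n]
    have h1 : ∑ k ∈ Finset.range n, q k ≤ 4 * L * s n := by
      calc _ ≤ ∑ k ∈ Finset.range n, 4 / (n : ℝ) * (((k + 1 : ℕ) : ℝ) * p (k + 1)) := by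
            refine Finset.sum_le_sum fun k _ => ?_
            refine (mul_le_mul_of_nonneg_left (min_le_right _ _) (hp _)).trans_eq ?_
            ring
        _ = 4 / (n : ℝ) * ∑ k ∈ Finset.range n, ((k + 1 : ℕ) : ℝ) * p (k + 1) := by
            rw [Finset.mul_sum]
        _ ≤ 4 / (n : ℝ) * (L * (n * s n)) := by
            refine mul_le_mul_of_nonneg_left (le_trans ?_ (hL n hn)) (by positivity)
            rw [← sum_mul_add_tail hps hs n]
            have : 0 ≤ s n := by rw [hs]; exact tsum_nonneg fun _ => hp _
            nlinarith
        _ = _ := by field_simp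
    have h2 : ∑' k, q (k + n) ≤ 2 * s n := by
      rw [hs, ← tsum_mul_left]
      exact ((summable_nat_add_iff n).2 hqs).tsum_le_tsum (fun k => hq2 (k + n))
        (((summable_nat_add_iff n).2 hps1).mul_left 2)
    linarith
  unfold renewalSeries
  rw [← (summable_renewal_term hps hR hz).tsum_sub (summable_renewal_term hps hR hw)]
  refine (tsum_of_norm_bounded (hqs.mul_left C).hasSum hterm).trans ?_
  rw [tsum_mul_left, mul_assoc]
  exact mul_le_mul_of_nonneg_left hqn hC

end Series

/-! ### Taylor coefficients of the resolvent -/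

section Coefficients

variable {B : Type*} [NormedAddCommGroup B] [NormedSpace ℂ B] [CompleteSpace B]
  {Rn : ℕ → B →L[ℂ] B} {p : ℕ → ℝ} {C : ℝ}

theorem differentiableOn_inverse_one_sub_renewalSeries (hps : Summable p)
    (hR : ∀ n : ℕ, 1 ≤ n → ‖Rn n‖ ≤ C * p n)
    (hU : ∀ z : ℂ, ‖z‖ < 1 → IsUnit (1 - renewalSeries Rn z)) :
    DifferentiableOn ℂ (fun z => Ring.inverse (1 - renewalSeries Rn z)) (Metric.ball 0 1) := by
  intro z hz
  have h1 : DifferentiableWithinAt ℂ (fun z => 1 - renewalSeries Rn z) (Metric.ball 0 1) z :=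
    (differentiableOn_renewalSeries hps hR z hz).const_sub 1
  exact (differentiableAt_inverse (𝕜 := ℂ) (hU z (by simpa using hz))).comp_differentiableWithinAt
    z h1

/-- The Taylor coefficients of `(I - R(z))⁻¹` at `0` are the renewal operators. -/
theorem coeff_cauchyPowerSeries_eq_renewalOp (hps : Summable p)
    (hR : ∀ n : ℕ, 1 ≤ n → ‖Rn n‖ ≤ C * p n)
    (hU : ∀ z : ℂ, ‖z‖ < 1 → IsUnit (1 - renewalSeries Rn z)) {r : NNReal} (hr0 : 0 < r)
    (hr1 : r < 1) (n : ℕ) :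
    (cauchyPowerSeries (fun z => Ring.inverse (1 - renewalSeries Rn z)) 0 r).coeff n =
      renewalOp Rn n := by
  set G : ℂ → B →L[ℂ] B := fun z => Ring.inverse (1 - renewalSeries Rn z) with hG
  set q := cauchyPowerSeries G 0 r with hq
  have hball : HasFPowerSeriesOnBall G q 0 r :=
    ((differentiableOn_inverse_one_sub_renewalSeries hps hR hU).mono
      (Metric.closedBall_subset_ball (by exact_mod_cast hr1))).hasFPowerSeriesOnBall hr0
  set R' : ℕ → B →L[ℂ] B := fun n => if n = 0 then 0 else Rn n with hR'
  set b : ℕ → B →L[ℂ] B := fun n => (if n = 0 then 1 else 0) +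
    ∑ k ∈ Finset.range (n + 1), q.coeff k * R' (n - k) with hb
  have hsum : ∀ z ∈ Metric.ball (0 : ℂ) r, HasSum (fun n => z ^ n • b n) (G z) := by
    intro z hz
    have hzr : ‖z‖ < r := by simpa using hz
    have hz1 : ‖z‖ < 1 := hzr.trans (by exact_mod_cast hr1)
    have hzr' : z ∈ Metric.eball (0 : ℂ) r := by
      rw [Metric.eball_coe]; exact hz
    have ha : HasSum (fun n => z ^ n • q.coeff n) (G z) := by
      simpa using hball.hasSum hzr'
    have han : Summable fun n => ‖z ^ n • q.coeff n‖ := by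
      simpa using q.summable_norm_apply (Metric.eball_subset_eball hball.r_le hzr')
    have hRn : Summable fun n => ‖z ^ n • R' n‖ := by
      rw [← summable_nat_add_iff 1]
      exact .of_nonneg_of_le (fun _ => norm_nonneg _) (norm_renewal_term_le hR hz1.le)
        (summable_renewal_bound hps)
    have hRs : ∑' n, z ^ n • R' n = renewalSeries Rn z := by
      rw [hRn.of_norm.tsum_eq_zero_add]
      simp [hR', renewalSeries]
    have hprod := tsum_mul_tsum_eq_tsum_sum_range_of_summable_norm han hRn
    have hprods := summable_norm_sum_mul_range_of_summable_norm han hRn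
    rw [hRs, ha.tsum_eq] at hprod
    have hGR : G z = 1 + G z * renewalSeries Rn z := by
      have := Ring.inverse_mul_cancel _ (hU z hz1)
      rw [mul_sub, mul_one, sub_eq_iff_eq_add] at this
      exact this
    have h0 : HasSum (fun n : ℕ => z ^ n • (if n = 0 then (1 : B →L[ℂ] B) else 0)) 1 := by
      convert hasSum_single (f := fun n : ℕ => z ^ n • (if n = 0 then (1 : B →L[ℂ] B) else 0)) 0
        (fun n hn => by simp [hn]) using 1
      simp
    rw [hGR]
    have hp := hprods.of_norm.hasSum
    rw [← hprod] at hp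
    refine (h0.add hp).congr_fun fun n => ?_
    rw [hb]
    simp only
    rw [smul_add, Finset.smul_sum]
    congr 1
    refine Finset.sum_congr rfl fun k hk => ?_
    rw [smul_mul_smul_comm, ← pow_add]
    congr 2
    have := Finset.mem_range.1 hk
    omega
  let q' : FormalMultilinearSeries ℂ ℂ (B →L[ℂ] B) :=
    fun n => ContinuousMultilinearMap.mkPiRing ℂ (Fin n) (b n)
  have hq' : ∀ n, q'.coeff n = b n := fun n => by simp [q', FormalMultilinearSeries.coeff]
  have hb' : HasFPowerSeriesAt G q' 0 := by
    refine hasFPowerSeriesAt_iff.2 ?_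
    filter_upwards [Metric.ball_mem_nhds (0 : ℂ) (by exact_mod_cast hr0 : (0 : ℝ) < r)] with z hz
    rw [zero_add]
    simpa only [hq'] using hsum z hz
  have hcoeff : ∀ n, q.coeff n = b n := fun n => by
    rw [hball.hasFPowerSeriesAt.eq_formalMultilinearSeries hb', hq']
  induction n using Nat.strong_induction_on with
  | _ n ih =>
    rw [hcoeff, hb]
    cases n with
    | zero => simp [hR', renewalOp, ContinuousLinearMap.one_def]
    | succ n =>
      have hlast : ∑ k ∈ Finset.range (n + 1 + 1), q.coeff k * R' (n + 1 - k) =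
          ∑ i ∈ Finset.range (n + 1), q.coeff (n + 1 - 1 - i) * R' (n + 1 - (n + 1 - 1 - i)) := by
        rw [Finset.sum_range_succ, ← Finset.sum_range_reflect]
        simp [hR']
      rw [renewalOp, Fin.sum_univ_eq_sum_range
        (fun i => (renewalOp Rn (n - i)).comp (Rn (i + 1)))]
      simp only [Nat.succ_ne_zero, if_false, zero_add]
      rw [hlast]
      refine Finset.sum_congr rfl fun i hi => ?_
      have := Finset.mem_range.1 hi
      rw [ih _ (by omega), show n + 1 - (n + 1 - 1 - i) = i + 1 by omega,
        show n + 1 - 1 - i = n - i by omega]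
      simp [hR', ContinuousLinearMap.mul_def]

end Coefficients

/-! ### The Riesz projection of a simple eigenvalue -/

section Riesz

theorem ContinuousLinearMap.map_circleIntegral {E F : Type*} [NormedAddCommGroup E]
    [NormedSpace ℂ E] [CompleteSpace E] [NormedAddCommGroup F] [NormedSpace ℂ F] [CompleteSpace F]
    (L : E →L[ℂ] F) {f : ℂ → E} {c : ℂ} {r : ℝ} (hf : CircleIntegrable f c r) :
    L (∮ z in C(c, r), f z) = ∮ z in C(c, r), L (f z) := by
  unfold circleIntegral
  rw [← L.intervalIntegral_comp_comm hf.out]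
  simp

variable {B : Type*} [NormedAddCommGroup B] [NormedSpace ℂ B]
  {A : B →L[ℂ] B} {c : ℂ} {r : ℝ}

theorem mem_resolventSet_of_mem_sphere (hr : 0 < r)
    (hA : spectrum ℂ A ∩ Metric.closedBall c r = {c}) {ζ : ℂ} (hζ : ζ ∈ Metric.sphere c r) :
    ζ ∈ resolventSet ℂ A := by
  by_contra h
  have : ζ ∈ spectrum ℂ A ∩ Metric.closedBall c r := ⟨h, Metric.sphere_subset_closedBall hζ⟩
  rw [hA, Set.mem_singleton_iff] at this
  rw [this, Metric.mem_sphere, dist_self] at hζ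
  exact hr.ne hζ

theorem sub_ne_zero_of_mem_sphere (hr : 0 < r) {ζ : ℂ} (hζ : ζ ∈ Metric.sphere c r) :
    ζ - c ≠ 0 := by
  rw [← norm_pos_iff, ← dist_eq_norm, Metric.mem_sphere.1 hζ]
  exact hr

variable [CompleteSpace B]

theorem continuousOn_resolvent_sphere (hr : 0 < r)
    (hA : spectrum ℂ A ∩ Metric.closedBall c r = {c}) :
    ContinuousOn (resolvent A) (Metric.sphere c r) := fun _ hζ =>
  (spectrum.hasDerivAt_resolvent_const_left
    (mem_resolventSet_of_mem_sphere hr hA hζ)).continuousAt.continuousWithinAt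

theorem circleIntegral_sub_inv_smul (hr : 0 < r) {E : Type*} [NormedAddCommGroup E]
    [NormedSpace ℂ E] [CompleteSpace E] (x : E) :
    (2 * (Real.pi : ℂ) * Complex.I)⁻¹ • ∮ ζ in C(c, r), (ζ - c)⁻¹ • x = x := by
  rw [circleIntegral.integral_smul_const, circleIntegral.integral_sub_center_inv c hr.ne',
    inv_smul_smul₀ Complex.two_pi_I_ne_zero]

/-- The Riesz projection for a simple isolated eigenvalue with eigenvector `e` and dual
eigenvector `f`. -/
theorem rieszProjection_apply_eq (hr : 0 < r) (hA : spectrum ℂ A ∩ Metric.closedBall c r = {c})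
    (hrank : Module.finrank ℂ (LinearMap.range (rieszProjection A c r : B →ₗ[ℂ] B)) = 1)
    {f : B →L[ℂ] ℂ} {e : B} (hfA : ∀ v, f (A v) = c * f v) (he : A e = c • e) (hfe : f e = 1)
    (v : B) : rieszProjection A c r v = f v • e := by
  have hint : CircleIntegrable (resolvent A) c r :=
    (continuousOn_resolvent_sphere hr hA).circleIntegrable hr.le
  have hmul : ∀ ζ ∈ Metric.sphere c r, ∀ w, resolvent A ζ (ζ • w - A w) = w := fun ζ hζ w => by
    have := Ring.inverse_mul_cancel _ (mem_resolventSet_of_mem_sphere hr hA hζ)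
    simpa [resolvent, Algebra.algebraMap_eq_smul_one] using congrArg (fun T : B →L[ℂ] B => T w) this
  have hmul' : ∀ ζ ∈ Metric.sphere c r, ∀ w,
      ζ • resolvent A ζ w - A (resolvent A ζ w) = w := fun ζ hζ w => by
    have := Ring.mul_inverse_cancel _ (mem_resolventSet_of_mem_sphere hr hA hζ)
    simpa [resolvent, Algebra.algebraMap_eq_smul_one] using congrArg (fun T : B →L[ℂ] B => T w) this
  have hPe : rieszProjection A c r e = e := by
    have h1 : rieszProjection A c r e = (2 * (Real.pi : ℂ) * Complex.I)⁻¹ •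
        ∮ ζ in C(c, r), resolvent A ζ e := by
      rw [rieszProjection, smul_apply]
      congr 1
      exact (ContinuousLinearMap.apply ℂ B e).map_circleIntegral hint
    rw [h1, circleIntegral.integral_congr hr.le (g := fun ζ => (ζ - c)⁻¹ • e),
      circleIntegral_sub_inv_smul hr]
    intro ζ hζ
    have hne := sub_ne_zero_of_mem_sphere hr hζ
    have := hmul ζ hζ e
    rw [he, ← sub_smul, map_smul] at this
    exact (eq_inv_smul_iff₀ hne).2 this
  have hfP : f (rieszProjection A c r v) = f v := by
    have h1 : f (rieszProjection A c r v) = (2 * (Real.pi : ℂ) * Complex.I)⁻¹ •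
        ∮ ζ in C(c, r), f (resolvent A ζ v) := by
      rw [rieszProjection, smul_apply, map_smul]
      congr 1
      exact (f.comp (ContinuousLinearMap.apply ℂ B v)).map_circleIntegral hint
    rw [h1, circleIntegral.integral_congr hr.le (g := fun ζ => (ζ - c)⁻¹ • f v),
      circleIntegral_sub_inv_smul hr]
    intro ζ hζ
    have hne := sub_ne_zero_of_mem_sphere hr hζ
    have := congrArg f (hmul' ζ hζ v)
    rw [map_sub, map_smul, hfA, smul_eq_mul, ← sub_mul] at this
    simp only [smul_eq_mul]
    rw [← this, inv_mul_cancel_left₀ hne]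
  have he0 : e ≠ 0 := fun h => by simp [h] at hfe
  let e' : LinearMap.range (rieszProjection A c r : B →ₗ[ℂ] B) := ⟨e, e, hPe⟩
  have he' : e' ≠ 0 := fun h => he0 (congrArg Subtype.val h)
  obtain ⟨a, ha⟩ := exists_smul_eq_of_finrank_eq_one hrank he' ⟨_, v, rfl⟩
  have ha' : a • e = rieszProjection A c r v := congrArg Subtype.val ha
  have := congrArg f ha'
  rw [map_smul, hfe, hfP, smul_eq_mul, mul_one] at this
  rw [← ha', this]

/-- The reduced resolvent: `c - A` is invertible modulo the Riesz projection. -/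
theorem exists_mul_eq_one_sub_rieszProjection (hr : 0 < r)
    (hA : spectrum ℂ A ∩ Metric.closedBall c r = {c}) :
    ∃ S : B →L[ℂ] B, (c • 1 - A) * S = 1 - rieszProjection A c r ∧
      S * (c • 1 - A) = 1 - rieszProjection A c r := by
  have hcont := continuousOn_resolvent_sphere hr hA
  have hcinv : ContinuousOn (fun ζ : ℂ => (ζ - c)⁻¹) (Metric.sphere c r) :=
    (continuousOn_id.sub continuousOn_const).inv₀ fun ζ hζ => sub_ne_zero_of_mem_sphere hr hζ
  have hint : CircleIntegrable (resolvent A) c r := hcont.circleIntegrable hr.le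
  have hint2 : CircleIntegrable (fun ζ => (ζ - c)⁻¹ • resolvent A ζ) c r :=
    (hcinv.smul hcont).circleIntegrable hr.le
  have hint3 : CircleIntegrable (fun ζ => (ζ - c)⁻¹ • (1 : B →L[ℂ] B)) c r :=
    (hcinv.smul continuousOn_const).circleIntegrable hr.le
  have key : (2 * (Real.pi : ℂ) * Complex.I)⁻¹ •
      (∮ ζ in C(c, r), ((ζ - c)⁻¹ • (1 : B →L[ℂ] B) - resolvent A ζ)) =
      1 - rieszProjection A c r := by
    rw [circleIntegral.integral_sub hint3 hint, smul_sub, circleIntegral_sub_inv_smul hr]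
    rfl
  refine ⟨(2 * (Real.pi : ℂ) * Complex.I)⁻¹ • ∮ ζ in C(c, r), (ζ - c)⁻¹ • resolvent A ζ, ?_, ?_⟩
  · rw [mul_smul_comm, ← key]
    congr 1
    refine ((ContinuousLinearMap.mul ℂ (B →L[ℂ] B) (c • 1 - A)).map_circleIntegral hint2).trans ?_
    refine circleIntegral.integral_congr hr.le fun ζ hζ => ?_
    have hne := sub_ne_zero_of_mem_sphere hr hζ
    have h1 := Ring.mul_inverse_cancel _ (mem_resolventSet_of_mem_sphere hr hA hζ)
    have e : c • 1 - A = (algebraMap ℂ (B →L[ℂ] B) ζ - A) - (ζ - c) • 1 := by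
      rw [Algebra.algebraMap_eq_smul_one, sub_smul]; abel
    simp only [ContinuousLinearMap.mul_apply']
    rw [mul_smul_comm, e, sub_mul, resolvent, h1, smul_sub, smul_mul_assoc, one_mul,
      inv_smul_smul₀ hne]
  · rw [smul_mul_assoc, ← key]
    congr 1
    refine (((ContinuousLinearMap.mul ℂ (B →L[ℂ] B)).flip
      (c • 1 - A)).map_circleIntegral hint2).trans ?_
    refine circleIntegral.integral_congr hr.le fun ζ hζ => ?_
    have hne := sub_ne_zero_of_mem_sphere hr hζ
    have h1 := Ring.inverse_mul_cancel _ (mem_resolventSet_of_mem_sphere hr hA hζ)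
    have e : c • 1 - A = (algebraMap ℂ (B →L[ℂ] B) ζ - A) - (ζ - c) • 1 := by
      rw [Algebra.algebraMap_eq_smul_one, sub_smul]; abel
    simp only [ContinuousLinearMap.flip_apply, ContinuousLinearMap.mul_apply']
    rw [smul_mul_assoc, e, mul_sub, resolvent, h1, smul_sub, mul_smul_comm, mul_one,
      inv_smul_smul₀ hne]

/-- If `1` is a simple isolated eigenvalue of `A` with eigenvector `e` and dual eigenvector `f`,
then the rank-one perturbation `1 - A + f(·) e` is invertible. -/
theorem IsSimpleIsolatedEigenvalue.isUnit_one_sub_add {A : B →L[ℂ] B}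
    (h : IsSimpleIsolatedEigenvalue A 1) {f : B →L[ℂ] ℂ} {e : B} (hfA : ∀ v, f (A v) = f v)
    (he : A e = e) (hfe : f e = 1) : IsUnit (1 - A + f.smulRight e) := by
  obtain ⟨r, hr, hA, hrank⟩ := h
  obtain ⟨S, hS1, hS2⟩ := exists_mul_eq_one_sub_rieszProjection hr hA
  have hP : rieszProjection A 1 r = f.smulRight e := ContinuousLinearMap.ext fun v =>
    rieszProjection_apply_eq hr hA hrank (by simpa using hfA) (by simpa using he) hfe v
  rw [hP, one_smul] at hS1 hS2
  set P := f.smulRight e with hPdef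
  have hAP : (1 - A + P) * P = P := by
    ext v; simp [hPdef, he, hfe]
  have hPA : P * (1 - A + P) = P := by
    ext v; simp [hPdef, hfA, hfe]
  have hright : (1 - A + P) * (S + P - P * S) = 1 := by
    rw [mul_sub, mul_add, ← mul_assoc, hAP, add_mul, hS1]; abel
  have hleft : (S + P - S * P) * (1 - A + P) = 1 := by
    rw [sub_mul, add_mul, mul_assoc, hPA, mul_add, hS2]; abel
  have heq : S + P - S * P = S + P - P * S := left_inv_eq_right_inv hleft hright
  exact ⟨⟨_, _, hright, heq ▸ hleft⟩, rfl⟩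

end Riesz

/-! ### Bounds for the resolvent near `z = 1` -/

section Bounds

variable {B : Type*} [NormedAddCommGroup B] [NormedSpace ℂ B]

/-- Solving `(1 - A) u = v` for a perturbation `A` of an operator `A₁` with simple eigenvalue `1`,
eigenvector `e` and dual eigenvector `f`. -/
theorem norm_le_of_one_sub_apply_eq {A A₁ : B →L[ℂ] B} {f : B →L[ℂ] ℂ} {e : B}
    (hfA : ∀ v, f (A₁ v) = f v) (he : A₁ e = e) (hfe : f e = 1)
    (hU : IsUnit (1 - A + f.smulRight e)) {M δ κ : ℝ}
    (hM : ‖Ring.inverse (1 - A + f.smulRight e)‖ ≤ M) (hδ : ‖A₁ - A‖ ≤ δ) (hκ : 0 < κ)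
    (hlow : κ + ‖f‖ * δ * (M * (δ * ‖e‖)) ≤ ‖1 - f (A e)‖) {u v : B} (huv : u - A u = v) :
    ‖u‖ ≤ M * ‖v‖ + M * ‖e‖ * ((‖f v‖ + ‖f‖ * δ * (M * ‖v‖)) / κ) := by
  set J := Ring.inverse (1 - A + f.smulRight e) with hJ
  have hM0 : 0 ≤ M := (norm_nonneg _).trans hM
  have hδ0 : 0 ≤ δ := (norm_nonneg _).trans hδ
  have hJl : ∀ w, J (w - A w + f w • e) = w := fun w => by
    simpa using congrArg (fun T : B →L[ℂ] B => T w) (Ring.inverse_mul_cancel _ hU)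
  have hJn : ∀ w, ‖J w‖ ≤ M * ‖w‖ := fun w => J.le_of_opNorm_le hM w
  have hD : ∀ w, ‖f ((A₁ - A) w)‖ ≤ ‖f‖ * δ * ‖w‖ := fun w => by
    refine (f.le_opNorm _).trans ?_
    rw [mul_assoc]
    exact mul_le_mul_of_nonneg_left ((A₁ - A).le_of_opNorm_le hδ w) (norm_nonneg _)
  have hu : u = J v + f u • J e := by
    rw [← map_smul, ← map_add, ← huv, hJl]
  have hJe : J e = e - J ((A₁ - A) e) := by
    have := hJl e
    rw [hfe, one_smul, map_add] at this
    rw [sub_apply, he]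
    exact eq_sub_of_add_eq' this
  have hfu : f u * f ((A₁ - A) (J e)) = f v - f ((A₁ - A) (J v)) := by
    have h1 : f ((A₁ - A) u) = f v := by
      rw [sub_apply, map_sub, hfA, ← huv, map_sub]
    have h2 := congrArg (fun w => f ((A₁ - A) w)) hu
    simp only [map_add, map_smul, smul_eq_mul] at h2
    rw [h1] at h2
    rw [h2]
    ring
  have hden : κ ≤ ‖f ((A₁ - A) (J e))‖ := by
    have h1 : f ((A₁ - A) (J e)) = (1 - f (A e)) - f ((A₁ - A) (J ((A₁ - A) e))) := by
      conv_lhs => rw [hJe, map_sub, map_sub]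
      congr 1
      rw [sub_apply, map_sub, hfA, hfe]
    have h2 : ‖f ((A₁ - A) (J ((A₁ - A) e)))‖ ≤ ‖f‖ * δ * (M * (δ * ‖e‖)) := by
      refine (hD _).trans ?_
      gcongr
      refine (hJn _).trans ?_
      gcongr
      exact (A₁ - A).le_of_opNorm_le hδ e
    rw [h1]
    have := norm_sub_norm_le (1 - f (A e)) (f ((A₁ - A) (J ((A₁ - A) e))))
    linarith
  have hfu' : ‖f u‖ ≤ (‖f v‖ + ‖f‖ * δ * (M * ‖v‖)) / κ := by
    rw [le_div_iff₀ hκ]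
    calc ‖f u‖ * κ ≤ ‖f u‖ * ‖f ((A₁ - A) (J e))‖ := by gcongr
      _ = ‖f v - f ((A₁ - A) (J v))‖ := by rw [← norm_mul, hfu]
      _ ≤ ‖f v‖ + ‖f ((A₁ - A) (J v))‖ := norm_sub_le _ _
      _ ≤ _ := by
        gcongr
        refine (hD _).trans ?_
        gcongr
        exact hJn v
  calc ‖u‖ ≤ ‖J v‖ + ‖f u • J e‖ := by
        conv_lhs => rw [hu]
        exact norm_add_le _ _
    _ ≤ M * ‖v‖ + ((‖f v‖ + ‖f‖ * δ * (M * ‖v‖)) / κ) * (M * ‖e‖) := by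
        rw [norm_smul]
        gcongr
        · exact hJn v
        · exact hJn e
    _ = _ := by ring

/-- The scale `m` with `m |1 - z| ≈ 1 / 2`. -/
theorem exists_nat_scale (N : ℕ) : ∃ ε > 0, ∀ z : ℂ, z ≠ 1 → ‖1 - z‖ < ε →
    ∃ m : ℕ, N ≤ m ∧ 1 ≤ m ∧ 2 * m * ‖1 - z‖ ≤ 1 ∧ 1 / 4 ≤ m * ‖1 - z‖ := by
  refine ⟨1 / (2 * (N + 1)), by positivity, fun z hz1 hz => ?_⟩
  have hx : 0 < ‖1 - z‖ := norm_pos_iff.2 (sub_ne_zero.2 hz1.symm)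
  set x := ‖1 - z‖
  have hN : (N + 1 : ℕ) ≤ ⌊1 / (2 * x)⌋₊ := by
    refine Nat.le_floor ?_
    rw [le_div_iff₀ (by positivity)]
    rw [lt_div_iff₀ (by positivity)] at hz
    push_cast
    linarith
  have hle : (⌊1 / (2 * x)⌋₊ : ℝ) ≤ 1 / (2 * x) := Nat.floor_le (by positivity)
  have hlt := Nat.lt_floor_add_one (1 / (2 * x))
  refine ⟨⌊1 / (2 * x)⌋₊, by omega, by omega, ?_, ?_⟩
  · rw [le_div_iff₀ (by positivity)] at hle
    linarith
  · have h1 : (1 : ℝ) ≤ ⌊1 / (2 * x)⌋₊ := by exact_mod_cast (by omega : 1 ≤ ⌊1 / (2 * x)⌋₊)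
    rw [div_lt_iff₀ (by positivity)] at hlt
    nlinarith

/-- The data of an operator renewal sequence with tail weights `s` (the tails of the probability
vector `p`), for which `1` is a simple eigenvalue of `R(1)`, with eigenvector `e` and dual
eigenvector `f`, and `1` is not in the spectrum of `R(z)` for `z ≠ 1`. -/
structure IsRenewalSystem (Rn : ℕ → B →L[ℂ] B) (p s : ℕ → ℝ) (C : ℝ) (f : B →L[ℂ] ℂ) (e : B) :
    Prop where
  nonneg : ∀ n, 0 ≤ p n
  summable : Summable p
  tail_eq : ∀ n, s n = ∑' k, p (k + n + 1)
  tail_zero : s 0 = 1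
  tail_pos : ∀ n, 0 < s n
  const_nonneg : 0 ≤ C
  norm_le : ∀ n : ℕ, 1 ≤ n → ‖Rn n‖ ≤ C * p n
  dual_apply : ∀ v, f (renewalSeries Rn 1 v) = f v
  apply_eigenvector : renewalSeries Rn 1 e = e
  dual_eigenvector : f e = 1
  dual_term : ∀ n : ℕ, 1 ≤ n → f (Rn n e) = p n
  isUnit_one_sub : ∀ z : ℂ, ‖z‖ ≤ 1 → z ≠ 1 → IsUnit (1 - renewalSeries Rn z)
  isUnit_one : IsUnit (1 - renewalSeries Rn 1 + f.smulRight e)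

namespace IsRenewalSystem

variable {Rn : ℕ → B →L[ℂ] B} {p s : ℕ → ℝ} {C : ℝ} {f : B →L[ℂ] ℂ} {e : B}

theorem antitone_tail (h : IsRenewalSystem Rn p s C f e) : Antitone s :=
  antitone_nat_of_succ_le fun n => by
    rw [tail_eq_add_tail h.summable h.tail_eq n]
    linarith [h.nonneg (n + 1)]

theorem tail_le_one (h : IsRenewalSystem Rn p s C f e) (n : ℕ) : s n ≤ 1 :=
  h.tail_zero ▸ h.antitone_tail n.zero_le

theorem tendsto_tail (h : IsRenewalSystem Rn p s C f e) : Tendsto s atTop (𝓝 0) := by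
  have := (tendsto_sum_nat_add p).comp (tendsto_add_atTop_nat 1)
  refine this.congr fun n => ?_
  rw [h.tail_eq]
  rfl

variable [CompleteSpace B]

theorem dual_series (h : IsRenewalSystem Rn p s C f e) {z : ℂ} (hz : ‖z‖ ≤ 1) :
    f (renewalSeries Rn z e) = ∑' n : ℕ, z ^ (n + 1) * (p (n + 1) : ℂ) := by
  have h1 := (summable_renewal_term h.summable h.norm_le hz).hasSum
  have h2 := (f.comp (ContinuousLinearMap.apply ℂ B e)).hasSum h1
  have h3 := h2.tsum_eq
  simp only [ContinuousLinearMap.comp_apply, ContinuousLinearMap.apply_apply] at h3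
  rw [renewalSeries, ← h3]
  congr 1
  funext n
  simp [h.dual_term (n + 1) (by omega)]

theorem exists_norm_inverse_add_le (h : IsRenewalSystem Rn p s C f e) :
    ∃ M > 0, ∃ ε > 0, ∀ z : ℂ, ‖z‖ ≤ 1 → ‖1 - z‖ < ε →
      IsUnit (1 - renewalSeries Rn z + f.smulRight e) ∧
      ‖Ring.inverse (1 - renewalSeries Rn z + f.smulRight e)‖ ≤ M := by
  obtain ⟨U, hU⟩ := h.isUnit_one
  have hcont : ContinuousWithinAt (fun z => 1 - renewalSeries Rn z + f.smulRight e)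
      (Metric.closedBall 0 1) 1 :=
    (continuousWithinAt_const.sub (continuousOn_renewalSeries h.summable h.norm_le 1
      (by simp))).add continuousWithinAt_const
  have hA1 : Tendsto (fun z => 1 - renewalSeries Rn z + f.smulRight e)
      (𝓝[Metric.closedBall 0 1] 1) (𝓝 (U : B →L[ℂ] B)) := by
    rw [hU]; exact hcont
  have hev1 := hA1.eventually (Units.nhds U)
  have hev2 := ((NormedRing.inverse_continuousAt U).tendsto.comp hA1).norm.eventually_lt_const
    (lt_add_one _)
  obtain ⟨ε, hε, hball⟩ := Metric.mem_nhdsWithin_iff.1 (hev1.and hev2)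
  refine ⟨‖Ring.inverse (U : B →L[ℂ] B)‖ + 1, by positivity, ε, hε, fun z hz hz1 => ?_⟩
  have := @hball z ⟨by rw [Metric.mem_ball, dist_comm, dist_eq_norm]; exact hz1,
    by simpa using hz⟩
  exact ⟨this.1, this.2.le⟩

theorem exists_norm_inverse_le_of_le_norm_one_sub (h : IsRenewalSystem Rn p s C f e) {ε : ℝ}
    (hε : 0 < ε) : ∃ M, ∀ z : ℂ, ‖z‖ ≤ 1 → ε ≤ ‖1 - z‖ →
      ‖Ring.inverse (1 - renewalSeries Rn z)‖ ≤ M := by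
  have hcompact : IsCompact (Metric.closedBall (0 : ℂ) 1 ∩ {z | ε ≤ ‖1 - z‖}) :=
    (isCompact_closedBall 0 1).inter_right
      (isClosed_le continuous_const (by fun_prop))
  have hcont : ContinuousOn (fun z => Ring.inverse (1 - renewalSeries Rn z))
      (Metric.closedBall (0 : ℂ) 1 ∩ {z | ε ≤ ‖1 - z‖}) := by
    intro z hz
    have hz1 : z ≠ 1 := by
      rintro rfl
      have : ε ≤ ‖(1 : ℂ) - 1‖ := hz.2
      simp only [sub_self, norm_zero] at this
      linarith
    obtain ⟨U, hU⟩ := h.isUnit_one_sub z (by simpa using hz.1) hz1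
    have h1 : Tendsto (fun z => 1 - renewalSeries Rn z)
        (𝓝[Metric.closedBall (0 : ℂ) 1 ∩ {z | ε ≤ ‖1 - z‖}] z) (𝓝 (U : B →L[ℂ] B)) := by
      rw [hU]
      exact continuousWithinAt_const.sub
        ((continuousOn_renewalSeries h.summable h.norm_le z hz.1).mono Set.inter_subset_left)
    have h2 := (NormedRing.inverse_continuousAt U).tendsto.comp h1
    rw [hU] at h2
    exact h2
  obtain ⟨M, hM⟩ := hcompact.exists_bound_of_continuousOn hcont
  exact ⟨M, fun z hz hz1 => hM z ⟨by simpa using hz, hz1⟩⟩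

theorem exists_norm_inverse_apply_le_near_one (h : IsRenewalSystem Rn p s C f e)
    {L : ℝ} (hL0 : 0 < L) (hL : ∀ n : ℕ, 1 ≤ n → ∑ k ∈ Finset.range n, s k ≤ L * (n * s n))
    {c : ℝ} (hc : 0 < c) {m₀ : ℕ} (hm₀ : ∀ m ≥ m₀, c * s m ≤ s m - s (2 * m)) :
    ∃ M > 0, ∃ ε > 0, ∀ z : ℂ, ‖z‖ ≤ 1 → z ≠ 1 → ‖1 - z‖ < ε →
      ∃ m : ℕ, 1 ≤ m ∧ 2 * m * ‖1 - z‖ ≤ 1 ∧ ∀ v,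
        ‖Ring.inverse (1 - renewalSeries Rn z) v‖ ≤ M * (‖v‖ + ‖f v‖ * (s m)⁻¹) := by
  obtain ⟨M, hM0, ε₁, hε₁, hM⟩ := h.exists_norm_inverse_add_le
  obtain ⟨D, hD⟩ : ∃ D, D = C * (4 * L + 2) := ⟨_, rfl⟩
  have hD0 : 0 ≤ D := hD ▸ mul_nonneg h.const_nonneg (by positivity)
  obtain ⟨Q, hQ⟩ : ∃ Q, Q = ‖f‖ * D * (M * (D * ‖e‖)) := ⟨_, rfl⟩
  have hQ0 : 0 ≤ Q := by rw [hQ]; positivity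
  obtain ⟨m₁, hm₁⟩ := eventually_atTop.1
    (h.tendsto_tail.eventually_lt_const (show 0 < c / 256 / (Q + 1) by positivity))
  obtain ⟨ε₂, hε₂, hscale⟩ := exists_nat_scale (max m₀ m₁)
  refine ⟨M + M * ‖e‖ * ((1 + ‖f‖ * D * M) / (c / 256)), by positivity, min ε₁ ε₂,
    lt_min hε₁ hε₂, fun z hz hz1 hzε => ?_⟩
  obtain ⟨hU, hJ⟩ := hM z hz (hzε.trans_le (min_le_left _ _))
  obtain ⟨m, hmN, hm1, hmx, hmx'⟩ := hscale z hz1 (hzε.trans_le (min_le_right _ _))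
  refine ⟨m, hm1, hmx, fun v => ?_⟩
  have hs0 := h.tail_pos m
  have hδ : ‖renewalSeries Rn 1 - renewalSeries Rn z‖ ≤ D * s m := by
    rw [hD]
    refine norm_renewalSeries_sub_le h.nonneg h.summable h.tail_eq h.const_nonneg h.norm_le hL
      (by simp) hz hm1 ?_
    rw [le_div_iff₀ (by exact_mod_cast hm1)]
    linarith
  have hQs : Q * s m ≤ c / 256 := by
    have := hm₁ m ((le_max_right _ _).trans hmN)
    rw [lt_div_iff₀ (by positivity)] at this
    linarith
  have hlow : c / 256 * s m + ‖f‖ * (D * s m) * (M * (D * s m * ‖e‖)) ≤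
      ‖1 - f (renewalSeries Rn z e)‖ := by
    rw [h.dual_series hz]
    refine le_trans ?_ (Complex.re_le_norm _)
    refine le_trans ?_ (tail_sub_le_re_one_sub_tsum h.nonneg h.summable h.tail_eq h.tail_zero
      hz hmx hmx')
    have h1 := hm₀ m ((le_max_left _ _).trans hmN)
    have h2 : ‖f‖ * (D * s m) * (M * (D * s m * ‖e‖)) = Q * s m * s m := by rw [hQ]; ring
    rw [h2]
    linarith [mul_le_mul_of_nonneg_right hQs hs0.le]
  have hinv : Ring.inverse (1 - renewalSeries Rn z) v -
      renewalSeries Rn z (Ring.inverse (1 - renewalSeries Rn z) v) = v := by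
    simpa using congrArg (fun T : B →L[ℂ] B => T v)
      (Ring.mul_inverse_cancel _ (h.isUnit_one_sub z hz hz1))
  have hsol := norm_le_of_one_sub_apply_eq h.dual_apply h.apply_eigenvector h.dual_eigenvector
    hU hJ hδ (by positivity) hlow (u := Ring.inverse (1 - renewalSeries Rn z) v) (v := v)
    hinv
  refine hsol.trans ?_
  have hfs : 0 ≤ ‖f v‖ * (s m)⁻¹ := by positivity
  have e1 : (‖f v‖ + ‖f‖ * (D * s m) * (M * ‖v‖)) / (c / 256 * s m) =
      (‖f v‖ * (s m)⁻¹ + ‖f‖ * D * M * ‖v‖) / (c / 256) := by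
    field_simp
  rw [e1, add_mul, mul_assoc (M * ‖e‖), div_mul_eq_mul_div]
  have hP : 0 ≤ ‖f‖ * D * M := by positivity
  have hv := norm_nonneg v
  gcongr
  · linarith
  · linarith [mul_nonneg hP hfs]

theorem exists_norm_inverse_le (h : IsRenewalSystem Rn p s C f e)
    {γ K : ℝ} (hγ0 : 0 < γ) (hγ1 : γ < 1) (hK : ∀ n : ℕ, 1 ≤ n → (s n)⁻¹ ≤ K * (n : ℝ) ^ γ)
    {L : ℝ} (hL0 : 0 < L) (hL : ∀ n : ℕ, 1 ≤ n → ∑ k ∈ Finset.range n, s k ≤ L * (n * s n))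
    {c : ℝ} (hc : 0 < c) {m₀ : ℕ} (hm₀ : ∀ m ≥ m₀, c * s m ≤ s m - s (2 * m)) :
    ∃ M > 0, ∀ z : ℂ, ‖z‖ < 1 →
      ‖Ring.inverse (1 - renewalSeries Rn z)‖ ≤ M * ‖1 - z‖ ^ (-γ) ∧
      ∀ v, f v = 0 → ‖Ring.inverse (1 - renewalSeries Rn z) v‖ ≤ M * ‖v‖ := by
  obtain ⟨M, hM0, ε, hε, hnear⟩ := h.exists_norm_inverse_apply_le_near_one hL0 hL hc hm₀
  obtain ⟨M₁, hM₁⟩ := h.exists_norm_inverse_le_of_le_norm_one_sub hε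
  have hK0 : 0 < K := by
    have := hK 1 le_rfl
    simp only [Nat.cast_one, Real.one_rpow, mul_one] at this
    exact (inv_pos.2 (h.tail_pos 1)).trans_le this
  have hA := abs_nonneg M₁
  refine ⟨M * (2 + ‖f‖ * K) + 2 * |M₁|, by positivity, fun z hz => ?_⟩
  have hz1 : z ≠ 1 := by rintro rfl; simp at hz
  have hx : 0 < ‖1 - z‖ := norm_pos_iff.2 (sub_ne_zero.2 hz1.symm)
  have hx2 : ‖1 - z‖ ≤ 2 := by
    refine (norm_sub_le _ _).trans ?_
    rw [norm_one]
    linarith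
  have hhalf : 1 ≤ 2 * ‖1 - z‖ ^ (-γ) := by
    have h1 : (2 : ℝ) ^ (-γ) ≤ ‖1 - z‖ ^ (-γ) :=
      Real.rpow_le_rpow_of_nonpos hx hx2 (by linarith)
    have h2 : (2 : ℝ) ^ (-1 : ℝ) ≤ 2 ^ (-γ) :=
      Real.rpow_le_rpow_of_exponent_le one_le_two (by linarith)
    rw [Real.rpow_neg_one] at h2
    linarith
  have hxpos : 0 < ‖1 - z‖ ^ (-γ) := Real.rpow_pos_of_pos hx _
  have hfK : 0 ≤ M * (‖f‖ * K) := by positivity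
  by_cases hzε : ‖1 - z‖ < ε
  · obtain ⟨m, hm1, hmx, hsol⟩ := hnear z hz.le hz1 hzε
    constructor
    · have hmle : (m : ℝ) ^ γ ≤ ‖1 - z‖ ^ (-γ) := by
        rw [Real.rpow_neg hx.le, ← Real.inv_rpow hx.le]
        refine Real.rpow_le_rpow m.cast_nonneg ?_ hγ0.le
        rw [← one_div, le_div_iff₀ hx]
        linarith [mul_nonneg (m.cast_nonneg : (0 : ℝ) ≤ m) hx.le]
      have hsm : (s m)⁻¹ ≤ K * ‖1 - z‖ ^ (-γ) :=
        (hK m hm1).trans (mul_le_mul_of_nonneg_left hmle hK0.le)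
      refine ContinuousLinearMap.opNorm_le_bound _ (by positivity) fun v => (hsol v).trans ?_
      calc M * (‖v‖ + ‖f v‖ * (s m)⁻¹)
          ≤ M * (2 * ‖1 - z‖ ^ (-γ) * ‖v‖ + ‖f‖ * ‖v‖ * (K * ‖1 - z‖ ^ (-γ))) := by
            gcongr
            · exact le_mul_of_one_le_left (norm_nonneg v) hhalf
            · exact inv_nonneg.2 (h.tail_pos m).le
            · exact f.le_opNorm v
        _ = (M * (2 + ‖f‖ * K) + 0) * ‖1 - z‖ ^ (-γ) * ‖v‖ := by ring
        _ ≤ _ := by gcongr; positivity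
    · intro v hv
      refine (hsol v).trans ?_
      rw [hv, norm_zero, zero_mul, add_zero]
      refine mul_le_mul_of_nonneg_right ?_ (norm_nonneg v)
      linarith
  · push Not at hzε
    have hb : ‖Ring.inverse (1 - renewalSeries Rn z)‖ ≤ |M₁| :=
      (hM₁ z hz.le hzε).trans (le_abs_self _)
    constructor
    · calc _ ≤ |M₁| * 1 := by rwa [mul_one]
        _ ≤ |M₁| * (2 * ‖1 - z‖ ^ (-γ)) := by gcongr
        _ = (0 + 2 * |M₁|) * ‖1 - z‖ ^ (-γ) := by ring
        _ ≤ _ := by gcongr; positivity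
    · intro v _
      refine (ContinuousLinearMap.le_of_opNorm_le _ hb v).trans ?_
      refine mul_le_mul_of_nonneg_right ?_ (norm_nonneg v)
      linarith

end IsRenewalSystem

end Bounds

/-! ### Fourier coefficients by translation -/

section Fourier

variable {E : Type*} [NormedAddCommGroup E] [NormedSpace ℂ E]

theorem ContinuousLinearMap.map_coeff_cauchyPowerSeries [CompleteSpace E] {F : Type*}
    [NormedAddCommGroup F] [NormedSpace ℂ F] [CompleteSpace F] (L : E →L[ℂ] F) {G : ℂ → E} {r : ℝ} (hr : 0 < r)
    (hG : ContinuousOn G (Metric.sphere 0 r)) (n : ℕ) :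
    L ((cauchyPowerSeries G 0 r).coeff n) = (cauchyPowerSeries (fun z => L (G z)) 0 r).coeff n := by
  have hinv : ContinuousOn (fun z : ℂ => (z - 0)⁻¹) (Metric.sphere 0 r) :=
    (continuousOn_id.sub continuousOn_const).inv₀ fun ζ hζ => sub_ne_zero_of_mem_sphere hr hζ
  have hint : CircleIntegrable (fun z : ℂ => (z - 0)⁻¹ ^ n • (z - 0)⁻¹ • G z) 0 r :=
    ((hinv.pow n).smul (hinv.smul hG)).circleIntegrable hr.le
  simp only [FormalMultilinearSeries.coeff, cauchyPowerSeries,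
    ContinuousMultilinearMap.mkPiRing_apply, Pi.one_apply, Finset.prod_const_one, one_smul,
    map_smul]
  rw [L.map_circleIntegral hint]
  simp

theorem coeff_cauchyPowerSeries_eq_integral (G : ℂ → E) {r : ℝ} (hr : 0 < r) (n : ℕ) :
    (cauchyPowerSeries G 0 r).coeff n = (2 * (Real.pi : ℂ))⁻¹ •
      ∫ θ in (-Real.pi)..Real.pi, (circleMap 0 r θ)⁻¹ ^ n • G (circleMap 0 r θ) := by
  have hper : Function.Periodic
      (fun θ : ℝ => (circleMap 0 r θ)⁻¹ ^ n • G (circleMap 0 r θ)) (2 * Real.pi) := fun θ => by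
    simp only [periodic_circleMap 0 r θ]
  have hshift := hper.intervalIntegral_add_eq 0 (-Real.pi)
  rw [zero_add, show -Real.pi + 2 * Real.pi = Real.pi by ring] at hshift
  simp only [FormalMultilinearSeries.coeff, cauchyPowerSeries,
    ContinuousMultilinearMap.mkPiRing_apply, Pi.one_apply, Finset.prod_const_one, one_smul,
    circleIntegral]
  rw [← hshift, mul_inv, mul_smul]
  congr 1
  rw [← intervalIntegral.integral_smul]
  refine intervalIntegral.integral_congr fun θ _ => ?_
  have hne : circleMap 0 r θ ≠ 0 := circleMap_ne_center hr.ne'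
  simp only [deriv_circleMap, sub_zero]
  rw [smul_smul, smul_smul, smul_smul]
  congr 1
  field_simp

/-- Comparison of a Taylor coefficient with its translate by half a period. -/
theorem norm_coeff_cauchyPowerSeries_le {G : ℂ → E} {r : ℝ} (hr : 0 < r)
    (hG : ContinuousOn G (Metric.sphere 0 r)) {n : ℕ} (hn : 1 ≤ n) {g : ℝ → ℝ}
    (hg : IntervalIntegrable g volume (-Real.pi) Real.pi)
    (hbound : ∀ θ ∈ Set.Ioc (-Real.pi) Real.pi, θ ≠ 0 →
      ‖G (circleMap 0 r θ) - G (circleMap 0 r (θ + Real.pi / n))‖ ≤ g θ) :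
    r ^ n * ‖(cauchyPowerSeries G 0 r).coeff n‖ ≤
      (4 * Real.pi)⁻¹ * ∫ θ in (-Real.pi)..Real.pi, g θ := by
  have hn0 : (n : ℝ) ≠ 0 := by exact_mod_cast (by omega : n ≠ 0)
  have hne : ∀ θ, circleMap 0 r θ ≠ 0 := fun θ => circleMap_ne_center hr.ne'
  have hGc : Continuous fun θ : ℝ => G (circleMap 0 r θ) :=
    hG.comp_continuous (continuous_circleMap 0 r) fun θ => circleMap_mem_sphere 0 hr.le θ
  have hic : Continuous fun θ : ℝ => (circleMap 0 r θ)⁻¹ ^ n :=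
    ((continuous_circleMap 0 r).inv₀ hne).pow n
  set k : ℝ → E := fun θ => (circleMap 0 r θ)⁻¹ ^ n • G (circleMap 0 r θ) with hk
  have hkc : Continuous k := hic.smul hGc
  have hper : Function.Periodic k (2 * Real.pi) := fun θ => by
    simp only [hk, periodic_circleMap 0 r θ]
  have hflip : ∀ θ, (circleMap 0 r (θ + Real.pi / n))⁻¹ ^ n = -(circleMap 0 r θ)⁻¹ ^ n := by
    intro θ
    have h1 : circleMap 0 r (θ + Real.pi / n) =
        circleMap 0 r θ * Complex.exp ((Real.pi / n : ℝ) * Complex.I) := by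
      simp only [circleMap, zero_add]
      rw [mul_assoc, ← Complex.exp_add]
      congr 2
      push_cast
      ring
    have h2 : Complex.exp ((Real.pi / n : ℝ) * Complex.I) ^ n = -1 := by
      rw [← Complex.exp_nat_mul, ← Complex.exp_pi_mul_I]
      congr 1
      have : (n : ℂ) ≠ 0 := by exact_mod_cast hn0
      push_cast
      field_simp
    rw [h1, inv_pow, mul_pow, h2, inv_pow]
    simp
  have hshift : ∫ θ in (-Real.pi)..Real.pi, k θ =
      ∫ θ in (-Real.pi)..Real.pi, k (θ + Real.pi / n) := by
    rw [intervalIntegral.integral_comp_add_right]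
    have := hper.intervalIntegral_add_eq (-Real.pi) (-Real.pi + Real.pi / n)
    rw [show -Real.pi + 2 * Real.pi = Real.pi by ring,
      show -Real.pi + Real.pi / n + 2 * Real.pi = Real.pi + Real.pi / n by ring] at this
    exact this
  have hsum : (2 : ℂ) • ∫ θ in (-Real.pi)..Real.pi, k θ =
      ∫ θ in (-Real.pi)..Real.pi, (circleMap 0 r θ)⁻¹ ^ n •
        (G (circleMap 0 r θ) - G (circleMap 0 r (θ + Real.pi / n))) := by
    rw [two_smul]
    conv_lhs => arg 2; rw [hshift]
    have hkc' : Continuous fun θ => k (θ + Real.pi / n) := hkc.comp (continuous_add_const _)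
    rw [← intervalIntegral.integral_add (hkc.intervalIntegrable _ _)
      (hkc'.intervalIntegrable _ _)]
    refine intervalIntegral.integral_congr fun θ _ => ?_
    simp only [hk, hflip]
    rw [neg_smul, smul_sub, sub_eq_add_neg]
  have hnorm : ‖(2 : ℂ) • ∫ θ in (-Real.pi)..Real.pi, k θ‖ ≤
      ∫ θ in (-Real.pi)..Real.pi, (r ^ n)⁻¹ * g θ := by
    rw [hsum]
    refine intervalIntegral.norm_integral_le_of_norm_le (by linarith [Real.pi_pos]) ?_
      (hg.const_mul _)
    filter_upwards [Measure.ae_ne volume (0 : ℝ)] with θ hθ0 hθ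
    rw [norm_smul, norm_pow, norm_inv, norm_circleMap_zero, abs_of_pos hr, inv_pow]
    exact mul_le_mul_of_nonneg_left (hbound θ hθ hθ0) (by positivity)
  rw [norm_smul, intervalIntegral.integral_const_mul, Complex.norm_ofNat] at hnorm
  rw [coeff_cauchyPowerSeries_eq_integral G hr, norm_smul, norm_inv, norm_mul, Complex.norm_ofNat,
    Complex.norm_real, Real.norm_of_nonneg Real.pi_pos.le]
  have hpi := Real.pi_pos
  have hrn : 0 < r ^ n := by positivity
  have h3 : r ^ n * ‖∫ θ in (-Real.pi)..Real.pi, k θ‖ ≤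
      2⁻¹ * ∫ θ in (-Real.pi)..Real.pi, g θ := by
    have := mul_le_mul_of_nonneg_left hnorm hrn.le
    rw [mul_inv_cancel_left₀ hrn.ne'] at this
    linarith
  calc _ = (2 * Real.pi)⁻¹ * (r ^ n * ‖∫ θ in (-Real.pi)..Real.pi, k θ‖) := by ring
    _ ≤ (2 * Real.pi)⁻¹ * (2⁻¹ * ∫ θ in (-Real.pi)..Real.pi, g θ) := by gcongr
    _ = _ := by rw [← mul_assoc, ← mul_inv]; congr 2; ring

theorem intervalIntegrable_abs_rpow_neg {γ : ℝ} (hγ : γ < 1) :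
    IntervalIntegrable (fun θ : ℝ => |θ| ^ (-γ)) volume (-Real.pi) Real.pi := by
  have h1 : IntervalIntegrable (fun θ : ℝ => |θ| ^ (-γ)) volume 0 Real.pi := by
    refine (intervalIntegral.intervalIntegrable_rpow' (a := 0) (b := Real.pi)
      (by linarith : -1 < -γ)).congr fun θ hθ => ?_
    rw [Set.uIoc_of_le Real.pi_pos.le] at hθ
    simp only [abs_of_pos hθ.1]
  have h2 : IntervalIntegrable (fun θ : ℝ => |θ| ^ (-γ)) volume (-Real.pi) 0 := by
    have := (IntervalIntegrable.iff_comp_neg (f := fun θ : ℝ => |θ| ^ (-γ))).1 h1.symm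
    simpa using this
  exact h2.trans h1

theorem abs_div_pi_le_norm_one_sub_circleMap {r θ : ℝ} (hr0 : 0 ≤ r) (hr1 : r ≤ 1)
    (hθ : |θ| ≤ Real.pi) : |θ| / Real.pi ≤ ‖1 - circleMap 0 r θ‖ := by
  have hpi := Real.pi_pos
  have h1 : 2 / Real.pi * |θ| ≤ ‖1 - circleMap 0 1 θ‖ := by
    have h2 : ‖1 - circleMap 0 1 θ‖ = ‖2 * Real.sin (θ / 2)‖ := by
      rw [← Complex.norm_exp_I_mul_ofReal_sub_one, norm_sub_rev]
      simp [circleMap, mul_comm]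
    rw [h2, norm_mul, Real.norm_two, Real.norm_eq_abs]
    have h3 := Real.mul_abs_le_abs_sin (x := θ / 2) (by rw [abs_div, abs_two]; linarith)
    rw [abs_div, abs_two] at h3
    calc 2 / Real.pi * |θ| = 2 * (2 / Real.pi * (|θ| / 2)) := by ring
      _ ≤ _ := by gcongr
  have h2 : ‖circleMap 0 r θ - circleMap 0 1 θ‖ = 1 - r := by
    have : circleMap 0 r θ - circleMap 0 1 θ = ((r - 1 : ℝ) : ℂ) * circleMap 0 1 θ := by
      simp [circleMap, sub_mul]
    rw [this, norm_mul, norm_circleMap_zero, abs_one, mul_one, Complex.norm_real,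
      Real.norm_eq_abs, abs_of_nonpos (by linarith)]
    ring
  have h3 : 1 - r ≤ ‖1 - circleMap 0 r θ‖ := by
    have := norm_sub_norm_le (1 : ℂ) (circleMap 0 r θ)
    rwa [norm_one, norm_circleMap_zero, abs_of_nonneg hr0] at this
  have h4 : ‖1 - circleMap 0 1 θ‖ ≤ ‖1 - circleMap 0 r θ‖ + (1 - r) := by
    rw [← h2]
    calc _ = ‖(1 - circleMap 0 r θ) + (circleMap 0 r θ - circleMap 0 1 θ)‖ := by
          rw [sub_add_sub_cancel]
      _ ≤ _ := norm_add_le _ _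
  have h5 : |θ| / Real.pi = 2 / Real.pi * |θ| / 2 := by ring
  rw [h5]
  linarith

theorem norm_circleMap_sub_circleMap_add_le {r : ℝ} (hr0 : 0 ≤ r) (hr1 : r ≤ 1) (θ t : ℝ) :
    ‖circleMap 0 r θ - circleMap 0 r (θ + t)‖ ≤ |t| := by
  have h := (lipschitzWith_circleMap 0 r).dist_le_mul θ (θ + t)
  rw [dist_eq_norm, dist_eq_norm, Real.coe_nnabs, abs_of_nonneg hr0] at h
  refine h.trans ?_
  rw [show θ - (θ + t) = -t by ring, norm_neg, Real.norm_eq_abs]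
  exact mul_le_of_le_one_left (abs_nonneg _) hr1

end Fourier

namespace IsRenewalSystem

variable {B : Type*} [NormedAddCommGroup B] [NormedSpace ℂ B]
  {Rn : ℕ → B →L[ℂ] B} {p s : ℕ → ℝ} {C : ℝ} {f : B →L[ℂ] ℂ} {e : B}

theorem inverse_sub_inverse_apply (h : IsRenewalSystem Rn p s C f e) {z w : ℂ} (hz : ‖z‖ < 1)
    (hw : ‖w‖ < 1) (v : B) :
    Ring.inverse (1 - renewalSeries Rn z) v - Ring.inverse (1 - renewalSeries Rn w) v =
      Ring.inverse (1 - renewalSeries Rn z) ((renewalSeries Rn z - renewalSeries Rn w)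
        (Ring.inverse (1 - renewalSeries Rn w) v)) := by
  have hne : ∀ x : ℂ, ‖x‖ < 1 → x ≠ 1 := by rintro x hx rfl; simp at hx
  have hz' := Ring.inverse_mul_cancel _ (h.isUnit_one_sub z hz.le (hne z hz))
  have hw' := Ring.mul_inverse_cancel _ (h.isUnit_one_sub w hw.le (hne w hw))
  have key : Ring.inverse (1 - renewalSeries Rn z) - Ring.inverse (1 - renewalSeries Rn w) =
      Ring.inverse (1 - renewalSeries Rn z) * (renewalSeries Rn z - renewalSeries Rn w) *
        Ring.inverse (1 - renewalSeries Rn w) := by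
    have e1 : renewalSeries Rn z - renewalSeries Rn w =
        (1 - renewalSeries Rn w) - (1 - renewalSeries Rn z) := by abel
    rw [e1, mul_sub, sub_mul, mul_assoc, hw', mul_one, hz', one_mul]
  exact congrArg (fun T : B →L[ℂ] B => T v) key

theorem exists_norm_renewalOp_le [CompleteSpace B]
    (h : IsRenewalSystem Rn p s C f e) {γ K : ℝ} (hγ0 : 0 < γ) (hγ1 : γ < 1) (hK : ∀ n : ℕ, 1 ≤ n → (s n)⁻¹ ≤ K * (n : ℝ) ^ γ)
    {L : ℝ} (hL0 : 0 < L) (hL : ∀ n : ℕ, 1 ≤ n → ∑ k ∈ Finset.range n, s k ≤ L * (n * s n))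
    {c : ℝ} (hc : 0 < c) {m₀ : ℕ} (hm₀ : ∀ m ≥ m₀, c * s m ≤ s m - s (2 * m)) :
    ∃ M > 0, ∀ v : B, f v = 0 → ∀ n : ℕ, 1 ≤ n → ‖renewalOp Rn n v‖ ≤ M * s n * ‖v‖ := by
  obtain ⟨M, hM0, hM⟩ := h.exists_norm_inverse_le hγ0 hγ1 hK hL0 hL hc hm₀
  have hpi := Real.pi_pos
  have hU : ∀ z : ℂ, ‖z‖ < 1 → IsUnit (1 - renewalSeries Rn z) := fun z hz =>
    h.isUnit_one_sub z hz.le (by rintro rfl; simp at hz)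
  obtain ⟨D, hD⟩ : ∃ D, D = C * (4 * L + 2) := ⟨_, rfl⟩
  have hD0 : 0 ≤ D := hD ▸ mul_nonneg h.const_nonneg (by positivity)
  obtain ⟨I, hI⟩ : ∃ I, I = ∫ θ in (-Real.pi)..Real.pi, |θ| ^ (-γ) := ⟨_, rfl⟩
  have hI0 : 0 ≤ I := by
    rw [hI]
    exact intervalIntegral.integral_nonneg (by linarith) fun θ _ =>
      Real.rpow_nonneg (abs_nonneg θ) _
  refine ⟨(4 * Real.pi)⁻¹ * (M * Real.pi ^ γ * D * M * I) + 1, by positivity,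
    fun v hv n hn => ?_⟩
  have hs0 := h.tail_pos n
  have hn0 : (0 : ℝ) < n := by exact_mod_cast hn
  have hr : ∀ r : NNReal, 0 < r → r < 1 → (r : ℝ) ^ n * ‖renewalOp Rn n v‖ ≤
      (4 * Real.pi)⁻¹ * (M * Real.pi ^ γ * D * M * I) * s n * ‖v‖ := by
    intro r hr0 hr1
    have hr0' : (0 : ℝ) < r := by exact_mod_cast hr0
    have hr1' : (r : ℝ) < 1 := by exact_mod_cast hr1
    have hcont : ContinuousOn (fun z => Ring.inverse (1 - renewalSeries Rn z))
        (Metric.sphere 0 r) :=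
      (differentiableOn_inverse_one_sub_renewalSeries h.summable h.norm_le hU).continuousOn.mono
        fun z hz => by
          rw [mem_sphere_zero_iff_norm] at hz
          rw [mem_ball_zero_iff, hz]
          exact hr1'
    have hcoeff : renewalOp Rn n v =
        (cauchyPowerSeries (fun z => Ring.inverse (1 - renewalSeries Rn z) v) 0 r).coeff n := by
      rw [← coeff_cauchyPowerSeries_eq_renewalOp h.summable h.norm_le hU hr0 hr1 n]
      exact (ContinuousLinearMap.apply ℂ B v).map_coeff_cauchyPowerSeries hr0' hcont n
    have hcont' : ContinuousOn (fun z => Ring.inverse (1 - renewalSeries Rn z) v)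
        (Metric.sphere 0 r) := hcont.clm_apply continuousOn_const
    rw [hcoeff]
    refine (norm_coeff_cauchyPowerSeries_le hr0' hcont' hn
      (g := fun θ => M * Real.pi ^ γ * D * M * s n * ‖v‖ * |θ| ^ (-γ))
      ((intervalIntegrable_abs_rpow_neg hγ1).const_mul _) ?_).trans_eq ?_
    · intro θ hθ hθ0
      have hnorm : ∀ t, ‖circleMap 0 (r : ℝ) t‖ < 1 := fun t => by
        rw [norm_circleMap_zero, abs_of_pos hr0']
        exact hr1'
      set z := circleMap 0 (r : ℝ) θ with hz
      set w := circleMap 0 (r : ℝ) (θ + Real.pi / n) with hw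
      have hzw : ‖z - w‖ ≤ 4 / n := by
        refine (norm_circleMap_sub_circleMap_add_le hr0'.le hr1'.le _ _).trans ?_
        rw [abs_of_pos (by positivity)]
        gcongr
        exact Real.pi_le_four
      have hRzw := norm_renewalSeries_sub_le h.nonneg h.summable h.tail_eq h.const_nonneg
        h.norm_le hL (hnorm θ).le (hnorm (θ + Real.pi / n)).le hn hzw
      rw [← hD] at hRzw
      have hθ' : |θ| ≤ Real.pi := abs_le.2 ⟨hθ.1.le, hθ.2⟩
      have hθpos : 0 < |θ| := abs_pos.2 hθ0
      have hpow : ‖1 - z‖ ^ (-γ) ≤ Real.pi ^ γ * |θ| ^ (-γ) := by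
        refine (Real.rpow_le_rpow_of_nonpos (by positivity)
          (abs_div_pi_le_norm_one_sub_circleMap hr0'.le hr1'.le hθ') (by linarith)).trans_eq ?_
        rw [Real.div_rpow (abs_nonneg _) hpi.le, Real.rpow_neg hpi.le, div_inv_eq_mul, mul_comm]
      rw [h.inverse_sub_inverse_apply (hnorm θ) (hnorm _)]
      calc _ ≤ M * ‖1 - z‖ ^ (-γ) * (D * s n * (M * ‖v‖)) := by
            refine ((Ring.inverse (1 - renewalSeries Rn z)).le_of_opNorm_le
              (hM z (hnorm θ)).1 _).trans ?_
            gcongr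
            refine (ContinuousLinearMap.le_of_opNorm_le _ hRzw _).trans ?_
            gcongr
            exact (hM w (hnorm _)).2 v hv
        _ ≤ M * (Real.pi ^ γ * |θ| ^ (-γ)) * (D * s n * (M * ‖v‖)) := by gcongr
        _ = _ := by ring
    · rw [intervalIntegral.integral_const_mul, ← hI]
      ring
  have hlim : Tendsto (fun r : NNReal => (r : ℝ) ^ n * ‖renewalOp Rn n v‖) (𝓝[<] 1)
      (𝓝 (((1 : NNReal) : ℝ) ^ n * ‖renewalOp Rn n v‖)) :=
    (Continuous.tendsto (by fun_prop) 1).mono_left nhdsWithin_le_nhds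
  have : (𝓝[<] (1 : NNReal)).NeBot := nhdsLT_neBot_of_exists_lt ⟨0, zero_lt_one⟩
  have hle := le_of_tendsto hlim (b := (4 * Real.pi)⁻¹ * (M * Real.pi ^ γ * D * M * I) * s n * ‖v‖)
    (by
      filter_upwards [Ioo_mem_nhdsLT (zero_lt_one (α := NNReal))] with r hr'
      exact hr r hr'.1 hr'.2)
  rw [NNReal.coe_one, one_pow, one_mul] at hle
  refine hle.trans ?_
  gcongr
  linarith

end IsRenewalSystem

/-! ### The transfer operator and the integral functionals -/

section Transfer

variable {Y : Type*} [MeasurableSpace Y] {μ : Measure Y}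

theorem ae_norm_le_norm_Lp_top (v : Lp ℂ ⊤ μ) : ∀ᵐ y ∂μ, ‖v y‖ ≤ ‖v‖ := by
  filter_upwards [ae_le_eLpNormEssSup (f := v) (μ := μ)] with y hy
  rw [← eLpNorm_exponent_top] at hy
  have := ENNReal.toReal_mono (Lp.eLpNorm_ne_top v) hy
  rwa [toReal_enorm] at this

theorem hasSum_setIntegral_fiber {φ : Y → ℕ} (hφ : Measurable φ) (m : ℕ)
    {g : Y → ℂ} (hg : Integrable g μ) {A : Set Y} (hA : MeasurableSet A) :
    HasSum (fun n : ℕ => ∫ y in A ∩ {y | φ y = n + m + 1}, g y ∂μ)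
      (∫ y in A ∩ {y | m < φ y}, g y ∂μ) := by
  have hU : ⋃ n : ℕ, A ∩ {y | φ y = n + m + 1} = A ∩ {y | m < φ y} := by
    ext y
    simp only [Set.mem_iUnion, Set.mem_inter_iff, Set.mem_ofPred_eq]
    constructor
    · rintro ⟨n, hy, hn⟩
      exact ⟨hy, by omega⟩
    · rintro ⟨hy, hn⟩
      exact ⟨φ y - m - 1, hy, by omega⟩
  rw [← hU]
  refine hasSum_integral_iUnion (fun n => hA.inter (hφ (measurableSet_singleton _))) ?_
    hg.integrableOn
  intro i j hij
  refine Set.disjoint_left.2 fun y hi hj => hij ?_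
  have h1 : φ y = i + m + 1 := hi.2
  have h2 : φ y = j + m + 1 := hj.2
  omega

variable [IsProbabilityMeasure μ]

theorem integrable_Lp_top (v : Lp ℂ ⊤ μ) : Integrable v μ :=
  (Lp.memLp v).integrable le_top

/-- Integration over `A` as a continuous functional on `L^∞`. -/
noncomputable def setIntegralFunctional (μ : Measure Y) [IsProbabilityMeasure μ] (A : Set Y) :
    Lp ℂ ⊤ μ →L[ℂ] ℂ :=
  LinearMap.mkContinuous
    { toFun := fun v => ∫ y in A, v y ∂μ
      map_add' := fun v w => by
        rw [← integral_add (integrable_Lp_top v).integrableOn (integrable_Lp_top w).integrableOn]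
        exact integral_congr_ae (ae_restrict_of_ae (Lp.coeFn_add v w))
      map_smul' := fun c v => by
        rw [RingHom.id_apply, ← integral_smul]
        exact integral_congr_ae (ae_restrict_of_ae (Lp.coeFn_smul c v)) }
    1 fun v => by
      rw [one_mul]
      refine (norm_setIntegral_le_of_norm_le_const_ae (measure_lt_top μ A)
        (ae_restrict_of_ae (ae_norm_le_norm_Lp_top v))).trans ?_
      exact mul_le_of_le_one_right (norm_nonneg v) measureReal_le_one

theorem setIntegralFunctional_apply (A : Set Y) (v : Lp ℂ ⊤ μ) :
    setIntegralFunctional μ A v = ∫ y in A, v y ∂μ := rfl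

theorem hasSum_measureReal_fiber {φ : Y → ℕ} (hφ : Measurable φ) (m : ℕ) :
    HasSum (fun n : ℕ => μ.real {y | φ y = n + m + 1}) (μ.real {y | m < φ y}) := by
  have := hasSum_setIntegral_fiber hφ m (integrable_const (μ := μ) (1 : ℂ)) MeasurableSet.univ
  simp only [Set.univ_inter, setIntegral_const, Complex.real_smul, mul_one] at this
  exact Complex.hasSum_ofReal.1 this

theorem setIntegral_transferOp_indicator {F : Y → Y} (hF : MeasurePreserving F μ μ) {φ : Y → ℕ}
    (hφ : Measurable φ) (n : ℕ) {g : Y → ℂ} (hg : Integrable g μ) {A : Set Y}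
    (hA : MeasurableSet A) :
    ∫ y in A, transferOp μ F (Set.indicator {y | φ y = n} g) y ∂μ =
      ∫ y in F ⁻¹' A ∩ {y | φ y = n}, g y ∂μ := by
  have hn : MeasurableSet {y | φ y = n} := hφ (measurableSet_singleton n)
  rw [setIntegral_transferOp hF (hg.indicator hn) hA, setIntegral_indicator hn]

variable {B : Type*} [NormedAddCommGroup B] [NormedSpace ℂ B] [CompleteSpace B]

/-- On `B`, the operator `R(1)` is the transfer operator of `F`. -/
theorem setIntegral_renewalSeries_one {F : Y → Y} (hF : MeasurePreserving F μ μ) {φ : Y → ℕ}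
    (hφ : Measurable φ) (hφ_pos : ∀ y, 1 ≤ φ y) (J : B →L[ℂ] Lp ℂ ⊤ μ)
    {Rn : ℕ → B →L[ℂ] B} (hRn : ∀ n : ℕ, 1 ≤ n → ∀ v : B,
      J (Rn n v) =ᵐ[μ] transferOp μ F (Set.indicator {y | φ y = n} (J v)))
    {p : ℕ → ℝ} {C : ℝ} (hps : Summable p) (hR : ∀ n : ℕ, 1 ≤ n → ‖Rn n‖ ≤ C * p n)
    {A : Set Y} (hA : MeasurableSet A) (v : B) :
    ∫ y in A, J (renewalSeries Rn 1 v) y ∂μ = ∫ y in F ⁻¹' A, J v y ∂μ := by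
  have hs := (summable_renewal_term hps hR (z := 1) (by simp)).hasSum
  have h1 := (((setIntegralFunctional μ A).comp J).comp (ContinuousLinearMap.apply ℂ B v)).hasSum hs
  simp only [one_pow, one_smul, ContinuousLinearMap.comp_apply, ContinuousLinearMap.apply_apply,
    setIntegralFunctional_apply] at h1
  have h2 := hasSum_setIntegral_fiber hφ 0 (integrable_Lp_top (J v)) (hF.measurable hA)
  have hall : F ⁻¹' A ∩ {y | 0 < φ y} = F ⁻¹' A := by
    rw [Set.inter_eq_left]
    exact fun y _ => hφ_pos y
  rw [hall] at h2
  have h3 : ∀ n : ℕ, ∫ y in A, J (Rn (n + 1) v) y ∂μ =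
      ∫ y in F ⁻¹' A ∩ {y | φ y = n + 0 + 1}, J v y ∂μ := fun n => by
    rw [integral_congr_ae (ae_restrict_of_ae (hRn (n + 1) (by omega) v))]
    exact setIntegral_transferOp_indicator hF hφ (n + 1) (integrable_Lp_top _) hA
  simp only [h3] at h1
  have := h1.unique h2
  simpa [renewalSeries] using this

end Transfer

theorem operator_renewal_bound_mean_zero
    {Y : Type*} [MeasurableSpace Y] (μ : Measure Y) [IsProbabilityMeasure μ]
    (F : Y → Y) (hF : MeasurePreserving F μ μ)
    (φ : Y → ℕ) (hφ_meas : Measurable φ) (hφ_pos : ∀ y, 1 ≤ φ y)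
    (l : ℝ → ℝ) (hl : SlowlyVarying l) (β : ℝ) (hβ0 : 0 < β) (hβ1 : β < 1)
    (htail : ∀ n : ℕ, 1 ≤ n → μ.real {y | n < φ y} = l n * (n : ℝ) ^ (-β))
    -- the Banach space `𝓑 ⊆ L^∞(Y, μ)`, with `ι` the inclusion
    {B : Type*} [NormedAddCommGroup B] [NormedSpace ℂ B] [CompleteSpace B]
    (ι : B →ₗ[ℂ] Lp ℂ ⊤ μ) (hι_inj : Function.Injective ι)
    (hι_norm : ∀ v : B, ‖ι v‖ ≤ ‖v‖)
    (hι_one : ∃ e : B, ι e =ᵐ[μ] fun _ => (1 : ℂ))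
    -- (H1): `Rₙ v = R(1_{φ = n} v)` restricts to a bounded operator on `𝓑`, with norm bound
    (Rn : ℕ → B →L[ℂ] B)
    (hRn : ∀ n : ℕ, 1 ≤ n → ∀ v : B,
      ι (Rn n v) =ᵐ[μ] transferOp μ F (Set.indicator {y | φ y = n} (ι v)))
    (C : ℝ) (hC : 0 < C)
    (hH1 : ∀ n : ℕ, 1 ≤ n → ‖Rn n‖ ≤ C * μ.real {y | φ y = n})
    -- (H2)
    (hH2i : IsSimpleIsolatedEigenvalue (renewalSeries Rn 1) 1)
    (hH2ii : ∀ z : ℂ, ‖z‖ ≤ 1 → z ≠ 1 → (1 : ℂ) ∉ spectrum ℂ (renewalSeries Rn z)) :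
    ∃ C' : ℝ, 0 < C' ∧ ∀ v : B, ∫ y, ι v y ∂μ = 0 → ∀ n : ℕ, 1 ≤ n →
      ‖renewalOp Rn n v‖ ≤ C' * (l n * (n : ℝ) ^ (-β)) * ‖v‖ := by
  obtain ⟨e, he⟩ := hι_one
  set J : B →L[ℂ] Lp ℂ ⊤ μ := ι.mkContinuous 1 (by simpa using hι_norm) with hJ
  set f : B →L[ℂ] ℂ := (setIntegralFunctional μ Set.univ).comp J with hf
  set p : ℕ → ℝ := fun n => μ.real {y | φ y = n} with hp
  set s : ℕ → ℝ := fun n => μ.real {y | n < φ y} with hs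
  have hf_apply : ∀ v, f v = ∫ y, ι v y ∂μ := fun v => by
    rw [← setIntegral_univ]
    rfl
  have hps : Summable p := (summable_nat_add_iff 1).1 (hasSum_measureReal_fiber hφ_meas 0).summable
  have hs0 : s 0 = 1 := by
    have : {y | 0 < φ y} = Set.univ := Set.eq_univ_of_forall hφ_pos
    simp only [hs, this, probReal_univ]
  have hspos : ∀ n, 0 < s n := fun n => by
    rcases Nat.eq_zero_or_pos n with rfl | hn
    · rw [hs0]
      exact one_pos
    · have hn0 : (0 : ℝ) < n := by exact_mod_cast hn
      simp only [hs, htail n hn]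
      exact mul_pos (hl.2.1 n hn0) (Real.rpow_pos_of_pos hn0 _)
  have hint : ∀ A : Set Y, MeasurableSet A → ∀ v,
      ∫ y in A, ι (renewalSeries Rn 1 v) y ∂μ = ∫ y in F ⁻¹' A, ι v y ∂μ := fun A hA v =>
    setIntegral_renewalSeries_one hF hφ_meas hφ_pos J hRn hps hH1 hA v
  have hιe : ∀ A : Set Y, ∫ y in A, ι e y ∂μ = μ.real A := fun A => by
    rw [integral_congr_ae (ae_restrict_of_ae he)]
    simp
  have hfe : f e = 1 := by
    rw [hf_apply, ← setIntegral_univ, hιe]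
    simp
  have hfR : ∀ v, f (renewalSeries Rn 1 v) = f v := fun v => by
    have := hint Set.univ MeasurableSet.univ v
    rwa [Set.preimage_univ, setIntegral_univ, setIntegral_univ, ← hf_apply, ← hf_apply] at this
  have hRe : renewalSeries Rn 1 e = e := by
    refine hι_inj (Lp.ext ?_)
    refine Integrable.ae_eq_of_forall_setIntegral_eq _ _ (integrable_Lp_top _)
      (integrable_Lp_top _) fun A hA _ => ?_
    rw [hint A hA, hιe, hιe, hF.measureReal_preimage hA.nullMeasurableSet]
  have hsys : IsRenewalSystem Rn p s C f e :=
    { nonneg := fun n => measureReal_nonneg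
      summable := hps
      tail_eq := fun n => (hasSum_measureReal_fiber hφ_meas n).tsum_eq.symm
      tail_zero := hs0
      tail_pos := hspos
      const_nonneg := hC.le
      norm_le := hH1
      dual_apply := hfR
      apply_eigenvector := hRe
      dual_eigenvector := hfe
      dual_term := fun n hn => by
        rw [hf_apply, integral_congr_ae (hRn n hn e), ← setIntegral_univ,
          setIntegral_transferOp_indicator hF hφ_meas n (integrable_Lp_top _) MeasurableSet.univ,
          hιe, Set.preimage_univ, Set.univ_inter]
      isUnit_one_sub := fun z hz hz1 => by
        have := spectrum.notMem_iff.1 (hH2ii z hz hz1)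
        rwa [map_one] at this
      isUnit_one := hH2i.isUnit_one_sub_add hfR hRe hfe }
  obtain ⟨⟨γ, K, hγ0, hγ1, hK⟩, ⟨L, hL0, hL⟩, c, hc, m₀, hm₀⟩ :=
    exists_tail_bounds hsys.antitone_tail hspos hsys.tail_le_one hβ0 hβ1
      (hl.tendsto_tail_ratio htail)
  obtain ⟨M, hM0, hM⟩ := hsys.exists_norm_renewalOp_le hγ0 hγ1 hK hL0 hL hc hm₀
  refine ⟨M, hM0, fun v hv n hn => ?_⟩
  rw [← htail n hn]
  exact hM v (by rw [hf_apply, hv]) n hn
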